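/- arXiv:0910.4441 — 3 statements merged into one kernel-verified Lean document; each statement's English description precedes it below -/
import Mathlib

section
/- Let N* ∈ M_r(𝓕) be a μ-generic matrix with inv(N*) = ν and inv(D_μ N*) = λ. Define real numbers k_ij for 1 ≤ i ≤ j ≤ r by k_{1j} + k_{2j} + … + k_{ij} = ‖((j−i)^∧, …, (j−1)^∧)‖ − ‖((j−i+1)^∧, …, (j)^∧)‖. Then |μ| + |ν| = |λ| and the family {k_ij} is an L𝕉 filling of type (μ, ν; λ). -/
open Matrix HahnSeries

noncomputable section

variable {K : Type*} [Field K] [CharZero K]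

/-- Membership in the valuation ring `R = {a ∈ 𝓕 : a = 0 ∨ ‖a‖ ≥ 0}` of
`𝓕 = HahnSeries ℝ K`. -/
def inR (a : HahnSeries ℝ K) : Prop := a = 0 ∨ 0 ≤ a.order

/-- `M ∈ GL_r(R)`: all entries of `M` lie in `R` and `M` has a two-sided inverse with
entries in `R`. -/
def InGLR {r : ℕ} (M : Matrix (Fin r) (Fin r) (HahnSeries ℝ K)) : Prop :=
  (∀ i j, inR (M i j)) ∧
    ∃ N : Matrix (Fin r) (Fin r) (HahnSeries ℝ K),
      (∀ i j, inR (N i j)) ∧ M * N = 1 ∧ N * M = 1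

/-- The diagonal matrix `D_μ = diag(t^{μ_1}, …, t^{μ_r})`. -/
def Dmat (K : Type*) [Field K] {r : ℕ} (μ : Fin r → ℝ) :
    Matrix (Fin r) (Fin r) (HahnSeries ℝ K) :=
  Matrix.diagonal fun i => HahnSeries.single (μ i) 1

/-- `D_ν̂ = diag(t^{ν_r}, …, t^{ν_1})`. -/
def DmatHat (K : Type*) [Field K] {r : ℕ} (ν : Fin r → ℝ) :
    Matrix (Fin r) (Fin r) (HahnSeries ℝ K) :=
  Dmat K fun i => ν i.rev

/-- `inv(M) = μ`: `μ` is weakly decreasing and `P M Q⁻¹ = D_μ` for some `P, Q ∈ GL_r(R)`. -/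
def IsInv {r : ℕ} (M : Matrix (Fin r) (Fin r) (HahnSeries ℝ K)) (μ : Fin r → ℝ) : Prop :=
  Antitone μ ∧ ∃ P Q : Matrix (Fin r) (Fin r) (HahnSeries ℝ K),
    InGLR P ∧ InGLR Q ∧ P * M * Q⁻¹ = Dmat K μ

/-- `Q` is `μ`-admissible: `Q ∈ GL_r(R)` and `D_μ Q D_μ⁻¹ ∈ GL_r(R)`. -/
def MuAdmissible {r : ℕ} (μ : Fin r → ℝ)
    (Q : Matrix (Fin r) (Fin r) (HahnSeries ℝ K)) : Prop :=
  InGLR Q ∧ InGLR (Dmat K μ * Q * (Dmat K μ)⁻¹)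

/-- `T` is `ν̂`-admissible: `T ∈ GL_r(R)` and `D_ν̂⁻¹ T D_ν̂ ∈ GL_r(R)`. -/
def NuHatAdmissible {r : ℕ} (ν : Fin r → ℝ)
    (T : Matrix (Fin r) (Fin r) (HahnSeries ℝ K)) : Prop :=
  InGLR T ∧ InGLR ((DmatHat K ν)⁻¹ * T * DmatHat K ν)

/-- The minor `W_{IJ}`: the determinant of the `k × k` submatrix of `W` on rows `I` and
columns `J`. -/
def minorDet {r k : ℕ} (W : Matrix (Fin r) (Fin r) (HahnSeries ℝ K))
    (I J : Fin k → Fin r) : HahnSeries ℝ K :=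
  (W.submatrix I J).det

/-- Pair equivalence: `(A, B) = (P M Q⁻¹, Q N T⁻¹)` for some `P, Q, T ∈ GL_r(R)`. -/
def PairEquiv {r : ℕ} (M N A B : Matrix (Fin r) (Fin r) (HahnSeries ℝ K)) : Prop :=
  ∃ P Q T : Matrix (Fin r) (Fin r) (HahnSeries ℝ K),
    InGLR P ∧ InGLR Q ∧ InGLR T ∧ A = P * M * Q⁻¹ ∧ B = Q * N * T⁻¹

/-- `N` is `μ`-generic: full rank, upper triangular, and for all index sets
`I ⊆ H ⊆ J` of equal length the minors `N_{IJ}, N_{HJ}, N_{IH}` are nonzero with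
`‖N_{IJ}‖ ≤ ‖N_{HJ}‖ ≤ ‖N_{IJ}‖ + |μ_I| − |μ_H|` and `‖N_{IJ}‖ ≤ ‖N_{IH}‖`. -/
def MuGeneric {r : ℕ} (μ : Fin r → ℝ)
    (N : Matrix (Fin r) (Fin r) (HahnSeries ℝ K)) : Prop :=
  N.det ≠ 0 ∧ (∀ i j : Fin r, j < i → N i j = 0) ∧
  ∀ (k : ℕ) (I H J : Fin k → Fin r), StrictMono I → StrictMono H → StrictMono J →
    (∀ s, I s ≤ H s) → (∀ s, H s ≤ J s) →
    minorDet N I J ≠ 0 ∧ minorDet N H J ≠ 0 ∧ minorDet N I H ≠ 0 ∧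
    (minorDet N I J).order ≤ (minorDet N H J).order ∧
    (minorDet N H J).order ≤ (minorDet N I J).order + (∑ s, μ (I s)) - ∑ s, μ (H s) ∧
    (minorDet N I J).order ≤ (minorDet N I H).order

/-- `L` is `μ`-`ν̂`-generic: `L ∈ GL_r(R)`, lower triangular, and for all index sets
`I ⊆ H ⊆ J` of equal length the relevant minors are nonzero with
`‖L_{IJ}‖ ≤ ‖L_{HJ}‖ ≤ ‖L_{IJ}‖ + |μ_I| − |μ_H|` and
`‖L_{IJ}‖ ≤ ‖L_{IH}‖ ≤ ‖L_{IJ}‖ + |ν̂_J| − |ν̂_H|`. -/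
def MuNuGeneric {r : ℕ} (μ ν : Fin r → ℝ)
    (L : Matrix (Fin r) (Fin r) (HahnSeries ℝ K)) : Prop :=
  InGLR L ∧ (∀ i j : Fin r, i < j → L i j = 0) ∧
  ∀ (k : ℕ) (I H J : Fin k → Fin r), StrictMono I → StrictMono H → StrictMono J →
    (∀ s, I s ≤ H s) → (∀ s, H s ≤ J s) →
    minorDet L I J ≠ 0 ∧ minorDet L H J ≠ 0 ∧ minorDet L I H ≠ 0 ∧
    (minorDet L I J).order ≤ (minorDet L H J).order ∧
    (minorDet L H J).order ≤ (minorDet L I J).order + (∑ s, μ (I s)) - (∑ s, μ (H s)) ∧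
    (minorDet L I J).order ≤ (minorDet L I H).order ∧
    (minorDet L I H).order ≤
      (minorDet L I J).order + (∑ s, ν ((J s).rev)) - ∑ s, ν ((H s).rev)

/-- The rightmost `k` columns `(r−k+1, …, r)` of an `r × r` matrix, as a map
`Fin k → Fin r`. -/
def lastCols (r k : ℕ) (h : k ≤ r) : Fin k → Fin r :=
  fun i => ⟨r - k + i.val, by have := i.isLt; omega⟩

/-- The set of (0-based) rows of an `r × r` matrix that remain after omitting the rows
with 1-based index in the interval `[p, q]`. -/
def keptRows (r p q : ℕ) : Finset (Fin r) :=
  (Finset.univ.filter fun x : Fin r => p ≤ x.val + 1 ∧ x.val + 1 ≤ q)ᶜ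

lemma keptRows_card_le (r p q : ℕ) : (keptRows r p q).card ≤ r := by
  simpa using (keptRows r p q).card_le_univ

/-- `‖((p)^∧, …, (q)^∧)‖` for the matrix `N`: the order of the minor of `N` on the rows
`{1, …, r} ∖ {p, …, q}` (1-based) and the rightmost columns; when `p > q` no row is
omitted and this is `‖det N‖`. -/
def hatOrd {r : ℕ} (N : Matrix (Fin r) (Fin r) (HahnSeries ℝ K)) (p q : ℕ) : ℝ :=
  (minorDet N (fun i => ((keptRows r p q).orderIsoOfFin rfl i).1)
    (lastCols r (keptRows r p q).card (keptRows_card_le r p q))).order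

/-- `k` is the right filling of a pair `(M, N)` with `inv(M) = μ`: there is a
`μ`-generic matrix `N*` with `(D_μ, N*)` pair-equivalent to `(M, N)` such that `k`
satisfies the determinantal formula
`k_{1j} + ⋯ + k_{ij} = ‖((j−i)^∧, …, (j−1)^∧)‖ − ‖((j−i+1)^∧, …, (j)^∧)‖`
(all indices written 1-based). -/
def RightFillingOf {r : ℕ} (μ : Fin r → ℝ)
    (M N : Matrix (Fin r) (Fin r) (HahnSeries ℝ K))
    (k : Fin r → Fin r → ℝ) : Prop :=
  ∃ Nstar : Matrix (Fin r) (Fin r) (HahnSeries ℝ K),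
    MuGeneric μ Nstar ∧ PairEquiv M N (Dmat K μ) Nstar ∧
    ∀ i j : Fin r, i ≤ j →
      ∑ s ∈ Finset.Iic i, k s j =
        hatOrd Nstar (j.val - i.val) j.val - hatOrd Nstar (j.val - i.val + 1) (j.val + 1)

/-- The left filling of `(M, N)` is the right filling of the transposed pair
`(Nᵀ, Mᵀ)`. -/
def LeftFillingOf {r : ℕ} (ν : Fin r → ℝ)
    (M N : Matrix (Fin r) (Fin r) (HahnSeries ℝ K))
    (m : Fin r → Fin r → ℝ) : Prop :=
  RightFillingOf ν Nᵀ Mᵀ m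

/-- `{k_ij : 1 ≤ i ≤ j ≤ r}` (indexed 0-based here) is an `L𝕉` filling of type
`(μ, ν; λ)`: the conditions (LR1)–(LR4). -/
def IsLRFilling {r : ℕ} (μ ν lam : Fin r → ℝ) (k : Fin r → Fin r → ℝ) : Prop :=
  (∀ j : Fin r, μ j + ∑ s ∈ Finset.Iic j, k s j = lam j) ∧
  (∀ i : Fin r, ∑ s ∈ Finset.Ici i, k i s = ν i) ∧
  (∀ i j : Fin r, i < j → 0 ≤ k i j) ∧
  (∀ (i j : ℕ) (hi : i < r) (hj : j < r), i ≤ j → 1 ≤ j →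
    μ ⟨j, hj⟩ + ∑ s ∈ Finset.Iic (⟨i, hi⟩ : Fin r), k s ⟨j, hj⟩ ≤
      μ ⟨j - 1, by omega⟩ + ∑ s ∈ Finset.Iio (⟨i, hi⟩ : Fin r), k s ⟨j - 1, by omega⟩) ∧
  (∀ (i j : ℕ) (hij : i ≤ j) (hj : j + 1 < r),
    ∑ s ∈ Finset.Icc (⟨i + 1, by omega⟩ : Fin r) ⟨j + 1, hj⟩, k ⟨i + 1, by omega⟩ s ≤
      ∑ s ∈ Finset.Icc (⟨i, by omega⟩ : Fin r) ⟨j, by omega⟩, k ⟨i, by omega⟩ s)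

section Sorting

variable {r : ℕ}

lemma StrictMono.val_le_add {k : ℕ} {f : Fin k → Fin r} (hf : StrictMono f) (i : Fin k) :
    (f i).val + k ≤ r + i.val := by
  obtain ⟨i, hi⟩ := i
  induction h : k - 1 - i generalizing i with
  | zero =>
    have := (f ⟨i, hi⟩).isLt
    simp only
    omega
  | succ n ih =>
    have h1 := ih (i + 1) (by omega) (by omega)
    have h2 : f ⟨i, hi⟩ < f ⟨i + 1, by omega⟩ := hf (by simp [Fin.lt_def])
    rw [Fin.lt_def] at h2
    simp only at h1 ⊢
    omega

lemma StrictMono.le_val {k : ℕ} {f : Fin k → Fin r} (hf : StrictMono f) (i : Fin k) (m : ℕ)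
    (hm : ∀ j, m ≤ (f j).val) : m + i.val ≤ (f i).val := by
  obtain ⟨i, hi⟩ := i
  induction i with
  | zero => simpa using hm _
  | succ n ih =>
    have h1 := ih (by omega)
    have h2 : f ⟨n, by omega⟩ < f ⟨n + 1, hi⟩ := hf (by simp [Fin.lt_def])
    rw [Fin.lt_def] at h2
    simp only at h1 ⊢
    omega

lemma StrictMono.le_lastCols {k : ℕ} {f : Fin k → Fin r} (hf : StrictMono f) (h : k ≤ r)
    (i : Fin k) : f i ≤ lastCols r k h i := by
  have := hf.val_le_add i
  simp only [lastCols, Fin.le_def]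
  omega

lemma StrictMono.eq_lastCols {k : ℕ} {f : Fin k → Fin r} (hf : StrictMono f) (h : k ≤ r)
    (hm : ∀ j, r ≤ (f j).val + k) : f = lastCols r k h := by
  funext i
  have h1 := hf.val_le_add i
  have h2 := hf.le_val i (r - k) fun j => by have := hm j; omega
  simp only [lastCols, Fin.ext_iff]
  omega

lemma lastCols_strictMono (k : ℕ) (h : k ≤ r) : StrictMono (lastCols r k h) := by
  intro i j hij
  simp only [lastCols, Fin.lt_def] at *
  omega

lemma exists_equiv_strictMono {ι : Type*} [Fintype ι] {k : ℕ} {f : ι → Fin r}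
    (hf : Function.Injective f) (h : Fintype.card ι = k) :
    ∃ e : Fin k ≃ ι, StrictMono (f ∘ e) := by
  let _ : LinearOrder ι := LinearOrder.lift' f hf
  refine ⟨(monoEquivOfFin ι h).toEquiv, fun i j hij => ?_⟩
  exact (monoEquivOfFin ι h).strictMono hij

/-- If there is an injection between the ranges of two strictly increasing sequences which moves
no element down, then the sequences are comparable. -/
lemma StrictMono.le_of_equiv {k : ℕ} {f g : Fin k → Fin r} (hf : StrictMono f)
    (hg : StrictMono g) (e : Fin k ≃ Fin k) (he : ∀ i, f (e i) ≤ g i) (i : Fin k) :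
    f i ≤ g i := by
  by_contra! hlt
  have hsub : (Finset.Iic i).map e.toEmbedding ⊆ Finset.Iio i := by
    intro x hx
    simp only [Finset.mem_map, Finset.mem_Iic, Equiv.coe_toEmbedding] at hx
    obtain ⟨j, hj, rfl⟩ := hx
    rw [Finset.mem_Iio]
    exact hf.lt_iff_lt.1 (((he j).trans (hg.monotone hj)).trans_lt hlt)
  have := Finset.card_le_card hsub
  simp at this

/-- The index set obtained from `A` by adjoining a smaller element is entrywise smaller. -/
lemma StrictMono.le_of_insert {k : ℕ} {f g : Fin k → Fin r} (hf : StrictMono f)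
    (hg : StrictMono g) {A : Finset (Fin r)} {u v : Fin r} (huv : u ≤ v) (hu : u ∉ A)
    (hfr : Finset.univ.image f = insert u A)
    (hgr : Finset.univ.image g = insert v A) (i : Fin k) : f i ≤ g i := by
  have hfm : ∀ x, x ∈ insert u A → ∃ j, f j = x := fun x hx => by
    rw [← hfr] at hx; simpa using hx
  have hgm : ∀ j, g j ∈ insert v A := fun j => by rw [← hgr]; simp
  have key : ∀ j, ∃ j', f j' = if g j = v then u else g j := fun j => by
    apply hfm
    have := hgm j
    split_ifs with h
    · simp
    · simp only [Finset.mem_insert, h, false_or] at this ⊢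
      exact Or.inr this
  choose e he using key
  have hinj : Function.Injective e := by
    intro a b hab
    have h1 := he a
    have h2 := he b
    rw [hab, h2] at h1
    apply hg.injective
    have ha := hgm a
    have hb := hgm b
    rw [Finset.mem_insert] at ha hb
    by_cases h3 : g a = v <;> by_cases h4 : g b = v
    · rw [h3, h4]
    · rw [if_pos h3, if_neg h4] at h1
      exact absurd (h1 ▸ hb.resolve_left h4) hu
    · rw [if_neg h3, if_pos h4] at h1
      exact absurd (h1 ▸ ha.resolve_left h3) hu
    · rw [if_neg h3, if_neg h4] at h1
      exact h1.symm
  refine hf.le_of_equiv hg (Equiv.ofBijective e (Finite.injective_iff_bijective.1 hinj))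
    (fun j => ?_) i
  rw [Equiv.ofBijective_apply, he]
  split_ifs with h
  · rw [h]; exact huv
  · exact le_rfl

end Sorting

section Minors

variable {F : Type*} [Field F]

variable {r : ℕ} {ι κ : Type*} [Fintype ι] [DecidableEq ι] [Fintype κ] [DecidableEq κ]

lemma orderTop_det_submatrix_perm (M : Matrix ι ι (HahnSeries ℝ F)) (σ : Equiv.Perm ι) :
    (M.submatrix σ id).det.orderTop = M.det.orderTop := by
  rw [Matrix.det_permute]
  rcases Int.units_eq_one_or (Equiv.Perm.sign σ) with h | h <;> simp [h]

/-- The order of a minor does not depend on the enumeration of its rows and columns. -/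
lemma orderTop_minor_comp_equiv (W : Matrix (Fin r) (Fin r) (HahnSeries ℝ F))
    (f g : ι → Fin r) (e e' : κ ≃ ι) :
    (W.submatrix (f ∘ e) (g ∘ e')).det.orderTop = (W.submatrix f g).det.orderTop := by
  have h1 : W.submatrix (f ∘ e) (g ∘ e') =
      ((W.submatrix f g).submatrix (e'.symm.trans e : Equiv.Perm ι) id).submatrix e' e' := by
    ext i j
    simp
  rw [h1, Matrix.det_submatrix_equiv_self, orderTop_det_submatrix_perm]

lemma minor_eq_zero_of_not_injective (W : Matrix (Fin r) (Fin r) (HahnSeries ℝ F))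
    (f g : ι → Fin r) (h : ¬ (Function.Injective f ∧ Function.Injective g)) :
    (W.submatrix f g).det = 0 := by
  rw [not_and_or] at h
  simp only [Function.Injective, not_forall] at h
  rcases h with ⟨a, b, hab, hne⟩ | ⟨a, b, hab, hne⟩
  · exact Matrix.det_zero_of_row_eq hne (by ext x; simp [hab])
  · exact Matrix.det_zero_of_column_eq hne (by intro x; simp [hab])

/-- To bound the orders of all minors from below it suffices to treat increasing index
sequences. -/
lemma le_orderTop_minor_of_strictMono (W : Matrix (Fin r) (Fin r) (HahnSeries ℝ F)) {k : ℕ}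
    {m : WithTop ℝ} (h : ∀ f g : Fin k → Fin r, StrictMono f → StrictMono g →
      m ≤ (W.submatrix f g).det.orderTop) (f g : Fin k → Fin r) :
    m ≤ (W.submatrix f g).det.orderTop := by
  by_cases hfg : Function.Injective f ∧ Function.Injective g
  · obtain ⟨e, he⟩ := exists_equiv_strictMono hfg.1 (Fintype.card_fin k)
    obtain ⟨e', he'⟩ := exists_equiv_strictMono hfg.2 (Fintype.card_fin k)
    rw [← orderTop_minor_comp_equiv W f g e e']
    exact h _ _ he he'
  · simp [minor_eq_zero_of_not_injective W f g hfg]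

/-- Minors of an upper triangular matrix vanish unless the rows are bounded by the columns. -/
lemma minor_eq_zero_of_upper {W : Matrix (Fin r) (Fin r) (HahnSeries ℝ F)}
    (hW : ∀ i j : Fin r, j < i → W i j = 0) {k : ℕ} {f g : Fin k → Fin r} (hf : StrictMono f)
    (hg : StrictMono g) (h : ¬ ∀ s, f s ≤ g s) : (W.submatrix f g).det = 0 := by
  push Not at h
  obtain ⟨s, hs⟩ := h
  rw [Matrix.det_apply]
  refine Finset.sum_eq_zero fun σ _ => ?_
  have : ∃ j, j ≤ s ∧ s ≤ σ j := by
    by_contra! hcon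
    have hsub : (Finset.Iic s).map σ.toEmbedding ⊆ Finset.Iio s := by
      intro x hx
      simp only [Finset.mem_map, Finset.mem_Iic, Equiv.coe_toEmbedding] at hx
      obtain ⟨j, hj, rfl⟩ := hx
      exact Finset.mem_Iio.2 (hcon j hj)
    have := Finset.card_le_card hsub
    simp at this
  obtain ⟨j, hj1, hj2⟩ := this
  rw [Finset.prod_eq_zero (Finset.mem_univ j), smul_zero]
  exact hW _ _ ((hg.monotone hj1).trans_lt (hs.trans_le (hf.monotone hj2)))

end Minors

section Schur

variable {F : Type*} [Field F]

variable {r : ℕ} {ι κ : Type*} [Fintype ι] [DecidableEq ι] [Fintype κ] [DecidableEq κ]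

/-- The entries of the Schur complement of the block of `W` on rows `f` and columns `g`. -/
def schurEntry (W : Matrix (Fin r) (Fin r) (HahnSeries ℝ F)) (f g : ι → Fin r) (u v : Fin r) :
    HahnSeries ℝ F :=
  W u v - (W.submatrix (fun _ : Unit => u) g * (W.submatrix f g)⁻¹ *
    W.submatrix f (fun _ : Unit => v)) () ()

lemma det_submatrix_sumElim (W : Matrix (Fin r) (Fin r) (HahnSeries ℝ F)) (f g : ι → Fin r)
    (h : (W.submatrix f g).det ≠ 0) (u v : κ → Fin r) :
    (W.submatrix (Sum.elim f u) (Sum.elim g v)).det =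
      (W.submatrix f g).det * (Matrix.of fun i j => schurEntry W f g (u i) (v j)).det := by
  let _ := (W.submatrix f g).invertibleOfIsUnitDet (isUnit_iff_ne_zero.2 h)
  have h1 : W.submatrix (Sum.elim f u) (Sum.elim g v) =
      fromBlocks (W.submatrix f g) (W.submatrix f v) (W.submatrix u g) (W.submatrix u v) := by
    ext i j
    rcases i with i | i <;> rcases j with j | j <;> rfl
  rw [h1, Matrix.det_fromBlocks₁₁]
  rw [Matrix.invOf_eq_nonsing_inv]
  rfl

end Schur

section RowOrd

variable {F : Type*} [Field F]

variable {r : ℕ}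

/-- The order of the minor of `N` on the rows `S` and the rightmost columns. -/
def rowOrd (N : Matrix (Fin r) (Fin r) (HahnSeries ℝ F)) (S : Finset (Fin r)) : ℝ :=
  (minorDet N (fun i => (S.orderIsoOfFin rfl i).1)
    (lastCols r S.card (by simpa using S.card_le_univ))).order

variable {μ : Fin r → ℝ} {N : Matrix (Fin r) (Fin r) (HahnSeries ℝ F)}

lemma MuGeneric.minor_lastCols_ne_zero (hN : MuGeneric μ N) {k : ℕ} {f : Fin k → Fin r}
    (hf : StrictMono f) (h : k ≤ r) : (N.submatrix f (lastCols r k h)).det ≠ 0 :=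
  (hN.2.2 k f f _ hf hf (lastCols_strictMono k h) (fun _ => le_rfl) (hf.le_lastCols h)).1

lemma rowOrd_eq_of_strictMono (N : Matrix (Fin r) (Fin r) (HahnSeries ℝ F)) {k : ℕ}
    {f : Fin k → Fin r} (hf : StrictMono f) (h : k ≤ r) {S : Finset (Fin r)}
    (hS : Finset.univ.image f = S) :
    rowOrd N S = (N.submatrix f (lastCols r k h)).det.order := by
  have hc : S.card = k := by rw [← hS, Finset.card_image_of_injective _ hf.injective]; simp
  subst hc
  have : f = S.orderEmbOfFin rfl :=
    Finset.orderEmbOfFin_unique rfl (fun x => by rw [← hS]; simp) hf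
  rw [this]
  rfl

lemma MuGeneric.coe_rowOrd (hN : MuGeneric μ N) {ι : Type*} [Fintype ι] [DecidableEq ι]
    {f g : ι → Fin r} (hf : Function.Injective f) (hg : Function.Injective g)
    {S : Finset (Fin r)} (hS : Finset.univ.image f = S)
    (hlast : ∀ j, r ≤ (g j).val + Fintype.card ι) :
    (rowOrd N S : WithTop ℝ) = (N.submatrix f g).det.orderTop := by
  have hk : Fintype.card ι ≤ r := by simpa using Fintype.card_le_of_injective f hf
  obtain ⟨e, he⟩ := exists_equiv_strictMono hf rfl
  obtain ⟨e', he'⟩ := exists_equiv_strictMono hg rfl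
  have hg' := he'.eq_lastCols hk fun j => hlast _
  rw [← orderTop_minor_comp_equiv N f g e e', hg', rowOrd_eq_of_strictMono N he hk,
    order_eq_orderTop_of_ne_zero (hN.minor_lastCols_ne_zero he hk)]
  rw [← hS]
  ext x
  simp only [Finset.mem_image, Finset.mem_univ, true_and, Function.comp]
  exact ⟨fun ⟨a, ha⟩ => ⟨_, ha⟩, fun ⟨a, ha⟩ => ⟨e.symm a, by simpa using ha⟩⟩

/-- Among the minors on fixed rows, the one on the rightmost columns has the least order. -/
lemma MuGeneric.lastCols_le (hN : MuGeneric μ N) {k : ℕ} {f g : Fin k → Fin r}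
    (hf : StrictMono f) (hg : StrictMono g) (h : k ≤ r) :
    (N.submatrix f (lastCols r k h)).det.orderTop ≤ (N.submatrix f g).det.orderTop := by
  by_cases hfg : ∀ s, f s ≤ g s
  · obtain ⟨h1, -, h3, -, -, h6⟩ :=
      hN.2.2 k f g _ hf hg (lastCols_strictMono k h) hfg (hg.le_lastCols h)
    have := WithTop.coe_le_coe.2 h6
    rwa [order_eq_orderTop_of_ne_zero h1, order_eq_orderTop_of_ne_zero h3] at this
  · simp [minor_eq_zero_of_upper hN.2.1 hf hg hfg]

lemma MuGeneric.rowOrd_le_minor (hN : MuGeneric μ N) {ι : Type*} [Fintype ι] [DecidableEq ι]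
    {f g : ι → Fin r} (hf : Function.Injective f) (hg : Function.Injective g)
    {S : Finset (Fin r)} (hS : Finset.univ.image f = S) :
    (rowOrd N S : WithTop ℝ) ≤ (N.submatrix f g).det.orderTop := by
  have hk : Fintype.card ι ≤ r := by simpa using Fintype.card_le_of_injective f hf
  obtain ⟨e, he⟩ := exists_equiv_strictMono hf rfl
  obtain ⟨e', he'⟩ := exists_equiv_strictMono hg rfl
  have h1 := hN.lastCols_le he he' hk
  rw [orderTop_minor_comp_equiv] at h1
  refine le_trans (le_of_eq ?_) h1
  refine hN.coe_rowOrd he.injective (lastCols_strictMono _ hk).injective ?_ ?_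
  · rw [← hS]
    ext x
    simp only [Finset.mem_image, Finset.mem_univ, true_and, Function.comp]
    exact ⟨fun ⟨a, ha⟩ => ⟨_, ha⟩, fun ⟨a, ha⟩ => ⟨e.symm a, by simpa using ha⟩⟩
  · intro j
    simp only [lastCols, Fintype.card_fin]
    omega

lemma MuGeneric.rowOrd_compare (hN : MuGeneric μ N) {k : ℕ} {f g : Fin k → Fin r}
    (hf : StrictMono f) (hg : StrictMono g) (hfg : ∀ s, f s ≤ g s) {S T : Finset (Fin r)}
    (hS : Finset.univ.image f = S) (hT : Finset.univ.image g = T) :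
    rowOrd N S ≤ rowOrd N T ∧ rowOrd N T + ∑ x ∈ T, μ x ≤ rowOrd N S + ∑ x ∈ S, μ x := by
  have hk : k ≤ r := by simpa using Fintype.card_le_of_injective f hf.injective
  obtain ⟨-, -, -, h4, h5, -⟩ :=
    hN.2.2 k f g _ hf hg (lastCols_strictMono k hk) hfg (hg.le_lastCols hk)
  rw [rowOrd_eq_of_strictMono N hf hk hS, rowOrd_eq_of_strictMono N hg hk hT, ← hS, ← hT,
    Finset.sum_image hf.injective.injOn, Finset.sum_image hg.injective.injOn]
  unfold minorDet at h4 h5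
  exact ⟨h4, by linarith⟩

lemma MuGeneric.rowOrd_exchange (hN : MuGeneric μ N) {A : Finset (Fin r)} {u v : Fin r}
    (huv : u ≤ v) (hu : u ∉ A) (hv : v ∉ A) :
    rowOrd N (insert u A) ≤ rowOrd N (insert v A) ∧
      rowOrd N (insert v A) + μ v ≤ rowOrd N (insert u A) + μ u := by
  have hcu : (insert u A).card = A.card + 1 := Finset.card_insert_of_notMem hu
  have hcv : (insert v A).card = A.card + 1 := Finset.card_insert_of_notMem hv
  have hf := ((insert u A).orderEmbOfFin hcu).strictMono
  have hg := ((insert v A).orderEmbOfFin hcv).strictMono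
  have hfi := (insert u A).image_orderEmbOfFin_univ hcu
  have hgi := (insert v A).image_orderEmbOfFin_univ hcv
  have h := hN.rowOrd_compare hf hg (hf.le_of_insert hg huv hu hfi hgi) hfi hgi
  rw [Finset.sum_insert hu, Finset.sum_insert hv] at h
  exact ⟨h.1, by linarith [h.2]⟩

/-- The orders of the minors on adjacent row sets expressed through one Schur complement. -/
lemma MuGeneric.exists_schur (hN : MuGeneric μ N) (A : Finset (Fin r)) (hA : A.card + 2 ≤ r) :
    ∃ (z : HahnSeries ℝ F) (s t : Fin r → HahnSeries ℝ F),
      (rowOrd N A : WithTop ℝ) = z.orderTop ∧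
      (∀ u ∉ A, (rowOrd N (insert u A) : WithTop ℝ) = (z * s u).orderTop) ∧
      (∀ u ∉ A, (rowOrd N (insert u A) : WithTop ℝ) ≤ (z * t u).orderTop) ∧
      ∀ u ∉ A, ∀ v ∉ A, u ≠ v → (rowOrd N (insert u (insert v A)) : WithTop ℝ) =
        (z * (s u * t v - t u * s v)).orderTop := by
  set n := A.card
  set f : Fin n → Fin r := ⇑(A.orderEmbOfFin rfl)
  have hf : StrictMono f := (A.orderEmbOfFin rfl).strictMono
  have hfA : Finset.univ.image f = A := A.image_orderEmbOfFin_univ rfl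
  have hfm : ∀ i, f i ∈ A := fun i => A.orderEmbOfFin_mem rfl i
  set g := lastCols r n (by omega)
  have hg : StrictMono g := lastCols_strictMono _ _
  have hgv : ∀ i, (g i).val = r - n + i.val := fun i => rfl
  have hz := hN.minor_lastCols_ne_zero hf (by omega)
  let p : Fin r := ⟨r - n - 1, by omega⟩
  let q : Fin r := ⟨r - n - 2, by omega⟩
  have hpq : p ≠ q := by simp only [p, q, ne_eq, Fin.ext_iff]; omega
  have hgp : ∀ i, g i ≠ p := fun i => by
    simp only [p, ne_eq, Fin.ext_iff, hgv]; omega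
  have hgq : ∀ i, g i ≠ q := fun i => by
    simp only [q, ne_eq, Fin.ext_iff, hgv]; omega
  have hone : ∀ u v, (N.submatrix (Sum.elim f fun _ : Unit => u)
      (Sum.elim g fun _ : Unit => v)).det = (N.submatrix f g).det * schurEntry N f g u v :=
    fun u v => by
      rw [det_submatrix_sumElim N f g hz]
      simp
  have hinj1 : ∀ {h : Fin n → Fin r} {u}, StrictMono h → (∀ i, h i ≠ u) →
      Function.Injective (Sum.elim h fun _ : Unit => u) := fun hh hu =>
    hh.injective.sumElim (Function.injective_of_subsingleton _) fun i _ => hu i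
  have hinj2 : ∀ {h : Fin n → Fin r} {u v}, StrictMono h → (∀ i, h i ≠ u) → (∀ i, h i ≠ v) →
      u ≠ v → Function.Injective (Sum.elim h ![u, v]) := fun hh hu hv huv =>
    hh.injective.sumElim (by
      intro i j hij
      fin_cases i <;> fin_cases j <;> simp_all [huv.symm]) fun i j => by
        fin_cases j
        · exact hu i
        · exact hv i
  have hne : ∀ {u}, u ∉ A → ∀ i, f i ≠ u := fun hu i h => hu (h ▸ hfm i)
  have him1 : ∀ u, Finset.univ.image (Sum.elim f fun _ : Unit => u) = insert u A := fun u => by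
    rw [← hfA]; ext x; simp [eq_comm, or_comm]
  refine ⟨(N.submatrix f g).det, fun u => schurEntry N f g u p, fun u => schurEntry N f g u q,
    hN.coe_rowOrd hf.injective hg.injective hfA fun j => ?_, fun u hu => ?_, fun u hu => ?_,
    fun u hu v hv huv => ?_⟩
  · rw [hgv, Fintype.card_fin]; omega
  · rw [← hone]
    refine hN.coe_rowOrd (hinj1 hf (hne hu)) (hinj1 hg hgp) (him1 u) ?_
    rintro (j | j)
    · simp [hgv]; omega
    · simp [p]; omega
  · rw [← hone]
    exact hN.rowOrd_le_minor (hinj1 hf (hne hu)) (hinj1 hg hgq) (him1 u)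
  · have := det_submatrix_sumElim N f g hz ![u, v] ![p, q]
    rw [Matrix.det_fin_two] at this
    simp only [Matrix.of_apply, Matrix.cons_val_zero, Matrix.cons_val_one] at this
    rw [← this]
    refine hN.coe_rowOrd (hinj2 hf (hne hu) (hne hv) huv) (hinj2 hg hgp hgq hpq) ?_ ?_
    · rw [← hfA]; ext x; simp [eq_comm]; tauto
    · rintro (j | j)
      · simp [hgv]; omega
      · fin_cases j <;> simp [p, q] <;> omega

/-- The tropical three-term Plücker relation between minors of two adjacent sizes. -/
lemma MuGeneric.rowOrd_plucker (hN : MuGeneric μ N) {A : Finset (Fin r)} {a b c : Fin r}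
    (ha : a ∉ A) (hb : b ∉ A) (hc : c ∉ A) (hab : a ≠ b) (hac : a ≠ c) (hbc : b ≠ c) :
    min (rowOrd N (insert a A) + rowOrd N (insert b (insert c A)))
      (rowOrd N (insert b A) + rowOrd N (insert a (insert c A))) ≤
      rowOrd N (insert c A) + rowOrd N (insert a (insert b A)) := by
  have hcard : A.card + 2 ≤ r := by
    have := (insert a (insert b A)).card_le_univ
    rw [Finset.card_insert_of_notMem (by simp [hab, ha]), Finset.card_insert_of_notMem hb] at this
    rw [Fintype.card_fin] at this
    omega
  obtain ⟨z, s, t, -, hs, -, hst⟩ := hN.exists_schur A hcard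
  rw [← WithTop.coe_le_coe, WithTop.coe_min, WithTop.coe_add, WithTop.coe_add, WithTop.coe_add,
    hs a ha, hs b hb, hs c hc, hst _ hb _ hc hbc, hst _ ha _ hc hac, hst _ ha _ hb hab,
    ← orderTop_mul, ← orderTop_mul, ← orderTop_mul]
  have : z * s c * (z * (s a * t b - t a * s b)) =
      z * s b * (z * (s a * t c - t a * s c)) - z * s a * (z * (s b * t c - t b * s c)) := by
    ring
  rw [this, min_comm]
  exact min_orderTop_le_orderTop_sub

/-- A consequence of the Desnanot–Jacobi identity. -/
lemma MuGeneric.rowOrd_supermodular (hN : MuGeneric μ N) {A : Finset (Fin r)} {a c : Fin r}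
    (ha : a ∉ A) (hc : c ∉ A) (hac : a ≠ c) :
    rowOrd N (insert a A) + rowOrd N (insert c A) ≤
      rowOrd N A + rowOrd N (insert a (insert c A)) := by
  have hcard : A.card + 2 ≤ r := by
    have := (insert a (insert c A)).card_le_univ
    rw [Finset.card_insert_of_notMem (by simp [hac, ha]), Finset.card_insert_of_notMem hc] at this
    rw [Fintype.card_fin] at this
    omega
  obtain ⟨z, s, t, hz, hs, ht, hst⟩ := hN.exists_schur A hcard
  rw [← WithTop.coe_le_coe, WithTop.coe_add, WithTop.coe_add, hz, hst _ ha _ hc hac,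
    ← orderTop_mul]
  have : z * (z * (s a * t c - t a * s c)) = z * s a * (z * t c) - z * t a * (z * s c) := by
    ring
  rw [this]
  refine le_trans (le_min ?_ ?_) min_orderTop_le_orderTop_sub
  · rw [orderTop_mul, ← hs a ha]
    gcongr
    exact ht c hc
  · rw [orderTop_mul, ← hs c hc]
    gcongr
    exact ht a ha

end RowOrd

section Invariants

variable {F : Type*} [Field F]

variable {r : ℕ}

lemma inR_iff_orderTop (a : HahnSeries ℝ F) : inR a ↔ 0 ≤ a.orderTop := by
  rw [zero_le_orderTop_iff, inR]
  refine ⟨?_, Or.inr⟩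
  rintro (rfl | h)
  · simp
  · exact h

lemma orderTop_prod_nonneg {ι : Type*} (s : Finset ι) (a : ι → HahnSeries ℝ F)
    (h : ∀ i ∈ s, 0 ≤ (a i).orderTop) : 0 ≤ (∏ i ∈ s, a i).orderTop := by
  refine Finset.prod_induction _ (fun x : HahnSeries ℝ F => 0 ≤ x.orderTop) (fun x y hx hy => ?_) ?_ h
  · rw [orderTop_mul]
    exact add_nonneg hx hy
  · rw [orderTop_one]

lemma le_orderTop_sum {ι : Type*} (s : Finset ι) (a : ι → HahnSeries ℝ F) (m : WithTop ℝ)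
    (h : ∀ i ∈ s, m ≤ (a i).orderTop) : m ≤ (∑ i ∈ s, a i).orderTop := by
  refine Finset.sum_induction _ (fun x : HahnSeries ℝ F => m ≤ x.orderTop) (fun x y hx hy => ?_) ?_ h
  · exact (le_min hx hy).trans min_orderTop_le_orderTop_add
  · simp

/-- A lower bound for the orders of all `k × k` minors. -/
def MinorBound (M : Matrix (Fin r) (Fin r) (HahnSeries ℝ F)) (k : ℕ) (m : WithTop ℝ) : Prop :=
  ∀ f g : Fin k → Fin r, m ≤ (M.submatrix f g).det.orderTop

lemma MinorBound.transpose {M : Matrix (Fin r) (Fin r) (HahnSeries ℝ F)} {k : ℕ}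
    {m : WithTop ℝ} (h : MinorBound M k m) : MinorBound Mᵀ k m := fun f g => by
  rw [← Matrix.det_transpose, Matrix.transpose_submatrix, Matrix.transpose_transpose]
  exact h g f

lemma MinorBound.mul_left {M P : Matrix (Fin r) (Fin r) (HahnSeries ℝ F)} {k : ℕ}
    {m : WithTop ℝ} (h : MinorBound M k m) (hP : ∀ i j, inR (P i j)) :
    MinorBound (P * M) k m := fun f g => by
  have h1 : ((P * M).submatrix f g).det =
      ∑ φ : Fin k → Fin r, (∏ i, P (f i) (φ i)) * (M.submatrix φ g).det := by
    have h2 : ((P * M).submatrix f g) =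
        fun i => ∑ t, P (f i) t • fun j => M t (g j) := by
      ext i j
      simp [Matrix.mul_apply]
    rw [h2]
    refine ((detRowAlternating (R := HahnSeries ℝ F)
      (n := Fin k)).toMultilinearMap.map_sum _).trans ?_
    refine Finset.sum_congr rfl fun φ _ => ?_
    exact (detRowAlternating (R := HahnSeries ℝ F)
      (n := Fin k)).toMultilinearMap.map_smul_univ _ _
  rw [h1]
  refine le_orderTop_sum _ _ _ fun φ _ => ?_
  rw [orderTop_mul]
  refine (h φ g).trans (le_add_of_nonneg_left ?_)
  exact orderTop_prod_nonneg _ _ fun i _ => (inR_iff_orderTop _).1 (hP _ _)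

lemma MinorBound.mul_right {M Q : Matrix (Fin r) (Fin r) (HahnSeries ℝ F)} {k : ℕ}
    {m : WithTop ℝ} (h : MinorBound M k m) (hQ : ∀ i j, inR (Q i j)) :
    MinorBound (M * Q) k m := by
  have := (h.transpose.mul_left (P := Qᵀ) fun i j => hQ j i).transpose
  rwa [← Matrix.transpose_mul, Matrix.transpose_transpose] at this

/-- The sum of the smallest `k` entries of a weakly decreasing tuple is a lower bound for its
subsums of length `k`. -/
lemma sum_lastCols_le {ν : Fin r → ℝ} (hν : Antitone ν) {k : ℕ} {f : Fin k → Fin r}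
    (hf : StrictMono f) (h : k ≤ r) : ∑ i, ν (lastCols r k h i) ≤ ∑ i, ν (f i) :=
  Finset.sum_le_sum fun i _ => hν (hf.le_lastCols h i)

lemma det_Dmat_mul_submatrix (μ : Fin r → ℝ) (M : Matrix (Fin r) (Fin r) (HahnSeries ℝ F))
    {k : ℕ} (f g : Fin k → Fin r) :
    (((Dmat F μ * M).submatrix f g).det).orderTop =
      ((∑ i, μ (f i) : ℝ) : WithTop ℝ) + (M.submatrix f g).det.orderTop := by
  have h1 : (Dmat F μ * M).submatrix f g =
      Matrix.of fun i j => single (μ (f i)) (1 : F) * M.submatrix f g i j := by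
    ext1 i j
    simp [Dmat, Matrix.diagonal_mul]
  have h2 : ∀ s : Finset (Fin k), (∏ i ∈ s, single (μ (f i)) (1 : F)).orderTop =
      ((∑ i ∈ s, μ (f i) : ℝ) : WithTop ℝ) := fun s => by
    induction s using Finset.induction_on with
    | empty => simp
    | insert a s ha ih =>
      rw [Finset.prod_insert ha, Finset.sum_insert ha, orderTop_mul, ih,
        orderTop_single one_ne_zero, WithTop.coe_add]
  rw [h1, Matrix.det_mul_column, orderTop_mul, h2]

lemma minorBound_Dmat {ν : Fin r → ℝ} (hν : Antitone ν) {k : ℕ} (h : k ≤ r) :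
    MinorBound (Dmat F ν) k ((∑ i, ν (lastCols r k h i) : ℝ) : WithTop ℝ) :=
  le_orderTop_minor_of_strictMono _ fun f g hf _ => by
    rw [← Matrix.mul_one (Dmat F ν), det_Dmat_mul_submatrix]
    refine (WithTop.coe_le_coe.2 (sum_lastCols_le hν hf h)).trans (le_add_of_nonneg_right ?_)
    rw [Matrix.det_apply]
    refine le_orderTop_sum _ _ _ fun σ _ => ?_
    have : 0 ≤ (∏ i, (1 : Matrix (Fin r) (Fin r) (HahnSeries ℝ F)).submatrix f g
        (σ i) i).orderTop := by
      refine orderTop_prod_nonneg _ _ fun i _ => ?_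
      rw [Matrix.submatrix_apply, Matrix.one_apply]
      split_ifs <;> simp
    rcases Int.units_eq_one_or (Equiv.Perm.sign σ) with hs | hs <;> simpa [hs] using this

/-- The order of an attained minimal `k × k` minor is the sum of the `k` smallest invariants. -/
lemma IsInv.sum_lastCols_eq {M : Matrix (Fin r) (Fin r) (HahnSeries ℝ F)} {ν : Fin r → ℝ}
    (hM : IsInv M ν) {k : ℕ} (h : k ≤ r) {m : ℝ} (hb : MinorBound M k m)
    (hm : ∃ f g : Fin k → Fin r, (M.submatrix f g).det.orderTop = m) :
    ∑ i, ν (lastCols r k h i) = m := by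
  obtain ⟨hν, P, Q, ⟨hP, P', hP', -, hP'P⟩, ⟨hQ, Q', hQ', hQQ', hQ'Q⟩, hD⟩ := hM
  have hQinv : Q⁻¹ = Q' := Matrix.inv_eq_right_inv hQQ'
  rw [hQinv] at hD
  have hMeq : M = P' * Dmat F ν * Q := by
    rw [← hD]
    calc M = (P' * P) * M * (Q' * Q) := by rw [hP'P, hQ'Q, Matrix.one_mul, Matrix.mul_one]
      _ = _ := by simp only [Matrix.mul_assoc]
  apply le_antisymm
  · obtain ⟨f, g, hfg⟩ := hm
    have := ((minorBound_Dmat (F := F) hν h).mul_left hP').mul_right hQ f g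
    rw [← hMeq, hfg] at this
    exact WithTop.coe_le_coe.1 this
  · have := (hb.mul_left hP).mul_right hQ' (lastCols r k h) (lastCols r k h)
    rw [hD, ← Matrix.mul_one (Dmat F ν), det_Dmat_mul_submatrix,
      Matrix.submatrix_one _ (lastCols_strictMono k h).injective, Matrix.det_one,
      orderTop_one, add_zero] at this
    exact WithTop.coe_le_coe.1 this

variable {μ ν lam : Fin r → ℝ} {N : Matrix (Fin r) (Fin r) (HahnSeries ℝ F)}

lemma sum_lastCols_eq_sum_filter (ν : Fin r → ℝ) {i : ℕ} (h : r - i ≤ r) :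
    ∑ s, ν (lastCols r (r - i) h s) = ∑ x with i ≤ x.val, ν x := by
  rw [← Finset.sum_image (s := Finset.univ) (g := lastCols r (r - i) h) (f := ν)
    (lastCols_strictMono _ h).injective.injOn]
  refine Finset.sum_congr ?_ fun _ _ => rfl
  ext x
  simp only [Finset.mem_image, Finset.mem_univ, true_and, Finset.mem_filter, lastCols,
    Fin.ext_iff]
  refine ⟨fun ⟨a, ha⟩ => by omega, fun hx => ?_⟩
  exact ⟨⟨x.val - i, by omega⟩, by simp only; omega⟩

/-- The sum of the smallest invariants of `N` is the order of its upper right minor. -/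
lemma MuGeneric.sum_inv_eq (hN : MuGeneric μ N) (hinv : IsInv N ν) (i : ℕ) :
    ∑ x with i ≤ x.val, ν x = rowOrd N {x | x.val + i < r} := by
  have h : r - i ≤ r := Nat.sub_le _ _
  rw [← sum_lastCols_eq_sum_filter ν h]
  let f0 : Fin (r - i) → Fin r := Fin.castLE h
  have hf0 : StrictMono f0 := Fin.strictMono_castLE h
  have hS : Finset.univ.image f0 = ({x | x.val + i < r} : Finset (Fin r)) := by
    ext x
    simp only [Finset.mem_image, Finset.mem_univ, true_and, Finset.mem_filter, f0, Fin.ext_iff,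
      Fin.val_castLE]
    exact ⟨fun ⟨a, ha⟩ => by omega, fun hx => ⟨⟨x.val, by omega⟩, rfl⟩⟩
  refine hinv.sum_lastCols_eq h (le_orderTop_minor_of_strictMono _ fun f g hf hg => ?_)
    ⟨f0, lastCols r (r - i) h, ?_⟩
  · refine le_trans (WithTop.coe_le_coe.2 ?_) (hN.rowOrd_le_minor hf.injective hg.injective rfl)
    refine (hN.rowOrd_compare hf0 hf (fun s => ?_) hS rfl).1
    have := hf.le_val s 0 (by simp)
    simpa [f0, Fin.le_def] using this
  · rw [rowOrd_eq_of_strictMono N hf0 h hS,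
      order_eq_orderTop_of_ne_zero (hN.minor_lastCols_ne_zero hf0 h)]

/-- The sum of the smallest invariants of `D_μ N` is read off its lower right minor. -/
lemma MuGeneric.sum_inv_mul_eq (hN : MuGeneric μ N) (hinv : IsInv (Dmat F μ * N) lam) (i : ℕ) :
    ∑ x with i ≤ x.val, lam x =
      rowOrd N {x | i ≤ x.val} + ∑ x with i ≤ x.val, μ x := by
  have h : r - i ≤ r := Nat.sub_le _ _
  rw [← sum_lastCols_eq_sum_filter lam h]
  have hl := lastCols_strictMono (r - i) h
  have hS : Finset.univ.image (lastCols r (r - i) h) =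
      ({x | i ≤ x.val} : Finset (Fin r)) := by
    ext x
    simp only [Finset.mem_image, Finset.mem_univ, true_and, Finset.mem_filter, lastCols,
      Fin.ext_iff]
    refine ⟨fun ⟨a, ha⟩ => by omega, fun hx => ?_⟩
    exact ⟨⟨x.val - i, by omega⟩, by simp only; omega⟩
  refine hinv.sum_lastCols_eq h (le_orderTop_minor_of_strictMono _ fun f g hf hg => ?_)
    ⟨lastCols r (r - i) h, lastCols r (r - i) h, ?_⟩
  · rw [det_Dmat_mul_submatrix]
    refine le_trans ?_
      (add_le_add_right (hN.rowOrd_le_minor hf.injective hg.injective rfl) _)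
    rw [← WithTop.coe_add, WithTop.coe_le_coe]
    have := (hN.rowOrd_compare hf hl (hf.le_lastCols h) rfl hS).2
    rw [Finset.sum_image hf.injective.injOn] at this
    linarith
  · rw [det_Dmat_mul_submatrix, rowOrd_eq_of_strictMono N hl h hS, WithTop.coe_add,
      order_eq_orderTop_of_ne_zero (hN.minor_lastCols_ne_zero hl h), add_comm, ← hS,
      Finset.sum_image hl.injective.injOn]

end Invariants

section Hat

variable {F : Type*} [Field F]

variable {r : ℕ} {μ : Fin r → ℝ} {N : Matrix (Fin r) (Fin r) (HahnSeries ℝ F)}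

lemma mem_keptRows {p q : ℕ} {x : Fin r} :
    x ∈ keptRows r p q ↔ ¬ (p ≤ x.val + 1 ∧ x.val + 1 ≤ q) := by
  simp [keptRows]

lemma hatOrd_eq_rowOrd (N : Matrix (Fin r) (Fin r) (HahnSeries ℝ F)) (p q : ℕ) :
    hatOrd N p q = rowOrd N (keptRows r p q) := rfl

lemma hatOrd_eq_of_lt (N : Matrix (Fin r) (Fin r) (HahnSeries ℝ F)) {p q : ℕ} (h : q < p) :
    hatOrd N p q = rowOrd N Finset.univ := by
  rw [hatOrd_eq_rowOrd]
  congr 1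
  ext x
  simp only [mem_keptRows, Finset.mem_univ, iff_true]
  omega

lemma hatOrd_zero (N : Matrix (Fin r) (Fin r) (HahnSeries ℝ F)) (q : ℕ) :
    hatOrd N 0 q = rowOrd N {x | q ≤ x.val} := by
  rw [hatOrd_eq_rowOrd]
  congr 1
  ext x
  simp only [mem_keptRows, Finset.mem_filter, Finset.mem_univ, true_and]
  omega

lemma hatOrd_one (N : Matrix (Fin r) (Fin r) (HahnSeries ℝ F)) (q : ℕ) :
    hatOrd N 1 q = hatOrd N 0 q := by
  rw [hatOrd_eq_rowOrd, hatOrd_eq_rowOrd]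
  congr 1
  ext x
  simp only [mem_keptRows]
  omega

lemma hatOrd_full (N : Matrix (Fin r) (Fin r) (HahnSeries ℝ F)) (i : ℕ) (hi : i ≤ r) :
    hatOrd N (r + 1 - i) r = rowOrd N {x | x.val + i < r} := by
  rw [hatOrd_eq_rowOrd]
  congr 1
  ext x
  simp only [mem_keptRows, Finset.mem_filter, Finset.mem_univ, true_and]
  omega

/-- Shifting a single omitted row down by one. -/
lemma MuGeneric.hatOrd_shift (hN : MuGeneric μ N) {j : ℕ} (hj : j < r) (h1 : 1 ≤ j) :
    hatOrd N (j + 1) (j + 1) ≤ hatOrd N j j ∧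
      hatOrd N j j + μ ⟨j, hj⟩ ≤ hatOrd N (j + 1) (j + 1) + μ ⟨j - 1, by omega⟩ := by
  have h := hN.rowOrd_exchange (A := keptRows r j (j + 1)) (u := ⟨j - 1, by omega⟩)
    (v := ⟨j, hj⟩) (by simp [Fin.le_def]) (by rw [mem_keptRows]; simp only; omega)
    (by rw [mem_keptRows]; simp only; omega)
  have e1 : insert ⟨j - 1, by omega⟩ (keptRows r j (j + 1)) = keptRows r (j + 1) (j + 1) := by
    ext x
    simp only [Finset.mem_insert, mem_keptRows, Fin.ext_iff]
    omega
  have e2 : insert ⟨j, hj⟩ (keptRows r j (j + 1)) = keptRows r j j := by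
    ext x
    simp only [Finset.mem_insert, mem_keptRows, Fin.ext_iff]
    omega
  rw [e1, e2] at h
  exact h

/-- The rhombus inequality behind nonnegativity of the entries of the filling. -/
lemma MuGeneric.hatOrd_rhombus_nonneg (hN : MuGeneric μ N) {p j : ℕ} (hj : j < r) (h1 : 1 ≤ p)
    (hp : p < j) :
    hatOrd N (p + 1) (j + 1) + hatOrd N (p + 1) j ≤ hatOrd N p j + hatOrd N (p + 2) (j + 1) := by
  let A := keptRows r p (j + 1)
  let a : Fin r := ⟨p - 1, by omega⟩
  let b : Fin r := ⟨p, by omega⟩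
  let c : Fin r := ⟨j, hj⟩
  have ha : a ∉ A := by rw [mem_keptRows]; simp only [a]; omega
  have hb : b ∉ A := by rw [mem_keptRows]; simp only [b]; omega
  have hc : c ∉ A := by rw [mem_keptRows]; simp only [c]; omega
  have hab : a < b := by simp only [a, b, Fin.lt_def]; omega
  have hbc : b < c := by simp only [b, c, Fin.lt_def]; omega
  have e1 : insert a A = keptRows r (p + 1) (j + 1) := by
    ext x; simp only [Finset.mem_insert, mem_keptRows, Fin.ext_iff, a, A]; omega
  have e2 : insert a (insert c A) = keptRows r (p + 1) j := by
    ext x; simp only [Finset.mem_insert, mem_keptRows, Fin.ext_iff, a, c, A]; omega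
  have e3 : insert c A = keptRows r p j := by
    ext x; simp only [Finset.mem_insert, mem_keptRows, Fin.ext_iff, c, A]; omega
  have e4 : insert a (insert b A) = keptRows r (p + 2) (j + 1) := by
    ext x; simp only [Finset.mem_insert, mem_keptRows, Fin.ext_iff, a, b, A]; omega
  simp only [hatOrd_eq_rowOrd, ← e1, ← e2, ← e3, ← e4]
  have h1 := hN.rowOrd_plucker ha hb hc hab.ne (hab.trans hbc).ne hbc.ne
  have h2 := (hN.rowOrd_exchange hab.le ha hb).1
  have h3 := (hN.rowOrd_exchange (A := insert c A) hab.le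
    (by simp [ha, (hab.trans hbc).ne]) (by simp [hb, hbc.ne])).1
  rcases min_le_iff.1 h1 with h | h <;> linarith

/-- The rhombus inequality behind the column-strictness condition on the filling. -/
lemma MuGeneric.hatOrd_rhombus_column (hN : MuGeneric μ N) {p j : ℕ} (hj : j < r) (h1 : 1 ≤ p)
    (hp : p < j) :
    μ ⟨j, hj⟩ + (hatOrd N p j - hatOrd N (p + 1) (j + 1)) ≤
      μ ⟨j - 1, by omega⟩ + (hatOrd N p (j - 1) - hatOrd N (p + 1) j) := by
  let A := keptRows r p (j + 1)
  let a : Fin r := ⟨p - 1, by omega⟩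
  let b : Fin r := ⟨j - 1, by omega⟩
  let c : Fin r := ⟨j, hj⟩
  have ha : a ∉ A := by rw [mem_keptRows]; simp only [a]; omega
  have hb : b ∉ A := by rw [mem_keptRows]; simp only [b]; omega
  have hc : c ∉ A := by rw [mem_keptRows]; simp only [c]; omega
  have hab : a < b := by simp only [a, b, Fin.lt_def]; omega
  have hbc : b < c := by simp only [b, c, Fin.lt_def]; omega
  have e1 : insert c A = keptRows r p j := by
    ext x; simp only [Finset.mem_insert, mem_keptRows, Fin.ext_iff, c, A]; omega
  have e2 : insert c (insert a A) = keptRows r (p + 1) j := by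
    ext x; simp only [Finset.mem_insert, mem_keptRows, Fin.ext_iff, a, c, A]; omega
  have e3 : insert a A = keptRows r (p + 1) (j + 1) := by
    ext x; simp only [Finset.mem_insert, mem_keptRows, Fin.ext_iff, a, A]; omega
  have e4 : insert b (insert c A) = keptRows r p (j - 1) := by
    ext x; simp only [Finset.mem_insert, mem_keptRows, Fin.ext_iff, b, c, A]; omega
  simp only [hatOrd_eq_rowOrd, ← e1, ← e2, ← e3, ← e4]
  have h1 := hN.rowOrd_plucker hb hc ha hbc.ne hab.ne' (hab.trans hbc).ne'
  have h2 := (hN.rowOrd_exchange hbc.le hb hc).2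
  have h3 := (hN.rowOrd_exchange (A := insert a A) hbc.le
    (by simp [hb, hab.ne']) (by simp [hc, (hab.trans hbc).ne'])).2
  change μ c + _ ≤ μ b + _
  rcases min_le_iff.1 h1 with h | h <;> linarith

/-- The rhombus inequality behind the lattice word condition on the filling. -/
lemma MuGeneric.hatOrd_rhombus_word (hN : MuGeneric μ N) {p j : ℕ} (hj : j < r) (h1 : 1 ≤ p)
    (hp : p ≤ j) :
    hatOrd N (p + 1) (j + 1) - hatOrd N p (j + 1) ≤ hatOrd N (p + 1) j - hatOrd N p j := by
  let A := keptRows r p (j + 1)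
  let a : Fin r := ⟨p - 1, by omega⟩
  let c : Fin r := ⟨j, hj⟩
  have ha : a ∉ A := by rw [mem_keptRows]; simp only [a]; omega
  have hc : c ∉ A := by rw [mem_keptRows]; simp only [c]; omega
  have hac : a < c := by simp only [a, c, Fin.lt_def]; omega
  have e1 : insert a A = keptRows r (p + 1) (j + 1) := by
    ext x; simp only [Finset.mem_insert, mem_keptRows, Fin.ext_iff, a, A]; omega
  have e2 : insert a (insert c A) = keptRows r (p + 1) j := by
    ext x; simp only [Finset.mem_insert, mem_keptRows, Fin.ext_iff, a, c, A]; omega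
  have e3 : insert c A = keptRows r p j := by
    ext x; simp only [Finset.mem_insert, mem_keptRows, Fin.ext_iff, c, A]; omega
  have h := hN.rowOrd_supermodular ha hc hac.ne
  simp only [hatOrd_eq_rowOrd, ← e1, ← e2, ← e3]
  linarith

variable {k : Fin r → Fin r → ℝ}

/-- The entries of a filling given by the determinantal formula. -/
lemma filling_entry_eq
    (hk : ∀ i j : Fin r, i ≤ j → ∑ s ∈ Finset.Iic i, k s j =
      hatOrd N (j.val - i.val) j.val - hatOrd N (j.val - i.val + 1) (j.val + 1))
    {i j : ℕ} (hij : i ≤ j) (hj : j < r) :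
    k ⟨i, by omega⟩ ⟨j, hj⟩ = hatOrd N (j - i) j - hatOrd N (j - i + 1) (j + 1) -
      hatOrd N (j - i + 1) j + hatOrd N (j - i + 2) (j + 1) := by
  have h := hk ⟨i, by omega⟩ ⟨j, hj⟩ hij
  simp only at h
  rcases i with _ | i
  · have : Finset.Iic (⟨0, by omega⟩ : Fin r) = {⟨0, by omega⟩} := by
      ext x; simp only [Finset.mem_Iic, Finset.mem_singleton, Fin.le_def, Fin.ext_iff]; omega
    rw [this, Finset.sum_singleton] at h
    rw [h, hatOrd_eq_of_lt N (p := j - 0 + 1) (q := j) (by omega),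
      hatOrd_eq_of_lt N (p := j - 0 + 2) (q := j + 1) (by omega)]
    ring
  · have h' := hk ⟨i, by omega⟩ ⟨j, hj⟩ (by simp only [Fin.le_def]; omega)
    have : Finset.Iic (⟨i + 1, by omega⟩ : Fin r) =
        insert ⟨i + 1, by omega⟩ (Finset.Iic ⟨i, by omega⟩) := by
      ext x; simp only [Finset.mem_Iic, Finset.mem_insert, Fin.le_def, Fin.ext_iff]; omega
    rw [this, Finset.sum_insert (by simp [Fin.le_def]), h'] at h
    simp only at h
    rw [show j - i = j - (i + 1) + 1 by omega] at h
    linarith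

/-- The partial row sums of a filling given by the determinantal formula. -/
lemma filling_row_sum_eq
    (hk : ∀ i j : Fin r, i ≤ j → ∑ s ∈ Finset.Iic i, k s j =
      hatOrd N (j.val - i.val) j.val - hatOrd N (j.val - i.val + 1) (j.val + 1))
    {i j : ℕ} (hij : i ≤ j) (hj : j < r) :
    ∑ s ∈ Finset.Icc (⟨i, by omega⟩ : Fin r) ⟨j, hj⟩, k ⟨i, by omega⟩ s =
      hatOrd N (j - i + 2) (j + 1) - hatOrd N (j - i + 1) (j + 1) := by
  induction j, hij using Nat.le_induction with
  | base =>
    rw [Finset.Icc_self, Finset.sum_singleton, filling_entry_eq hk le_rfl hj, Nat.sub_self,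
      Nat.zero_add, hatOrd_one N i]
    ring
  | succ j hij ih =>
    have : Finset.Icc (⟨i, by omega⟩ : Fin r) ⟨j + 1, hj⟩ =
        insert ⟨j + 1, hj⟩ (Finset.Icc ⟨i, by omega⟩ ⟨j, by omega⟩) := by
      ext x
      simp only [Finset.mem_Icc, Finset.mem_insert, Fin.le_def, Fin.ext_iff]
      omega
    rw [this, Finset.sum_insert (by simp [Fin.le_def]), ih (by omega),
      filling_entry_eq hk (by omega) hj, show j + 1 - i = j - i + 1 by omega]
    ring

lemma sum_filter_le_eq (a : Fin r → ℝ) (i : Fin r) :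
    ∑ x with i.val ≤ x.val, a x = a i + ∑ x with i.val + 1 ≤ x.val, a x := by
  rw [← Finset.sum_insert (by simp)]
  refine Finset.sum_congr ?_ fun _ _ => rfl
  ext x
  simp only [Finset.mem_filter, Finset.mem_univ, true_and, Finset.mem_insert, Fin.ext_iff]
  omega

end Hat
/-- The determinantal formula applied to a `μ`-generic matrix `N*` with
`inv(N*) = ν` and `inv(D_μ N*) = λ` produces an `L𝕉` filling of type `(μ, ν; λ)`
(here the defining partial sums `k_{1j} + ⋯ + k_{ij}` are written with 0-based indices). -/
theorem determinantal_formula_gives_LR_filling {r : ℕ} (μ ν lam : Fin r → ℝ)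
    (hμ : Antitone μ)
    (N : Matrix (Fin r) (Fin r) (HahnSeries ℝ K)) (hN : MuGeneric μ N)
    (hinvN : IsInv N ν) (hinvDN : IsInv (Dmat K μ * N) lam)
    (k : Fin r → Fin r → ℝ)
    (hk : ∀ i j : Fin r, i ≤ j →
      ∑ s ∈ Finset.Iic i, k s j =
        hatOrd N (j.val - i.val) j.val - hatOrd N (j.val - i.val + 1) (j.val + 1)) :
    ((∑ i, μ i) + ∑ i, ν i = ∑ i, lam i) ∧ IsLRFilling μ ν lam k := by
  have hcol : ∀ j : Fin r, μ j + ∑ s ∈ Finset.Iic j, k s j = lam j := by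
    intro j
    have h1 := hN.sum_inv_mul_eq hinvDN j.val
    have h2 := hN.sum_inv_mul_eq hinvDN (j.val + 1)
    rw [sum_filter_le_eq lam, sum_filter_le_eq μ] at h1
    rw [hk j j le_rfl, Nat.sub_self, Nat.zero_add, hatOrd_one, hatOrd_zero, hatOrd_zero]
    linarith
  refine ⟨?_, hcol, fun i => ?_, fun i j hij => ?_, fun i j hi hj hij h1 => ?_,
    fun i j hij hj => ?_⟩
  · have h1 := hN.sum_inv_eq hinvN 0
    have h2 := hN.sum_inv_mul_eq hinvDN 0
    simp only [Nat.add_zero, Fin.is_lt, Nat.zero_le, Finset.filter_true] at h1 h2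
    linarith
  · have hr : r - 1 < r := by have := i.isLt; omega
    have hIci : Finset.Ici i = Finset.Icc i ⟨r - 1, hr⟩ := by
      ext x
      simp only [Finset.mem_Ici, Finset.mem_Icc, Fin.le_def]
      omega
    have h1 := hN.sum_inv_eq hinvN i.val
    have h2 := hN.sum_inv_eq hinvN (i.val + 1)
    rw [sum_filter_le_eq ν] at h1
    rw [hIci, filling_row_sum_eq hk (show i.val ≤ r - 1 by omega) hr, Nat.sub_add_cancel (by omega),
      show r - 1 - i.val + 2 = r + 1 - i.val by omega,
      show r - 1 - i.val + 1 = r + 1 - (i.val + 1) by omega, hatOrd_full N _ (by omega),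
      hatOrd_full N _ (by omega)]
    linarith
  · obtain ⟨i, hi⟩ := i
    obtain ⟨j, hj⟩ := j
    rw [Fin.mk_lt_mk] at hij
    rw [filling_entry_eq hk hij.le hj]
    rcases i with _ | i
    · have h := (hN.hatOrd_shift hj (by omega)).1
      rw [hatOrd_eq_of_lt N (p := j - 0 + 1) (q := j) (by omega),
        hatOrd_eq_of_lt N (p := j - 0 + 2) (q := j + 1) (by omega), Nat.sub_zero]
      linarith
    · have h := hN.hatOrd_rhombus_nonneg hj (p := j - (i + 1)) (by omega) (by omega)
      linarith
  · rcases hij.eq_or_lt with rfl | hlt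
    · have hIio : Finset.Iio (⟨i, hi⟩ : Fin r) = Finset.Iic ⟨i - 1, by omega⟩ := by
        ext x
        simp only [Finset.mem_Iio, Finset.mem_Iic, Fin.le_def, Fin.lt_def]
        omega
      rw [hIio, hcol, hcol]
      exact hinvDN.1 (by simp [Fin.le_def])
    · rw [hk _ _ hij]
      rcases i with _ | i
      · have hIio : Finset.Iio (⟨0, hi⟩ : Fin r) = ∅ := by
          ext x
          simp [Fin.lt_def]
        have h := (hN.hatOrd_shift hj h1).2
        rw [hIio, Finset.sum_empty]
        simp only [Nat.sub_zero]
        linarith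
      · have hIio : Finset.Iio (⟨i + 1, hi⟩ : Fin r) = Finset.Iic ⟨i, by omega⟩ := by
          ext x
          simp only [Finset.mem_Iio, Finset.mem_Iic, Fin.le_def, Fin.lt_def]
          omega
        rw [hIio, hk _ _ (by simp only [Fin.le_def]; omega)]
        have h := hN.hatOrd_rhombus_column hj (p := j - (i + 1)) (by omega) (by omega)
        simp only
        rwa [show j - 1 - i = j - (i + 1) by omega, Nat.sub_add_cancel h1]
  · rw [filling_row_sum_eq hk (by omega) hj, filling_row_sum_eq hk hij (by omega)]
    have h := hN.hatOrd_rhombus_word hj (p := j - i + 1) (by omega) (by omega)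
    rwa [show j + 1 - (i + 1) = j - i by omega]

end
end

section
/- Let {k_ij : 1 ≤ i ≤ j ≤ r} be an L𝕉 filling of type (μ, ν; λ). Define M = diag(t^{μ_1}, …, t^{μ_r}), and for 1 ≤ i ≤ r define the block matrix N_i = diag(1_{i−1}, T_i), where 1_{i−1} is the (i−1)×(i−1) identity and T_i is the (r−i+1)×(r−i+1) upper-bidiagonal matrix with diagonal entries t^{k_{i,i}}, t^{k_{i,i+1}}, …, t^{k_{i,r}} and with 1's on the superdiagonal. Set N = N_1 N_2 ⋯ N_r. Then inv(M) = μ, inv(N) = ν, and inv(MN) = λ. -/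
open Matrix HahnSeries

noncomputable section

variable {K : Type*} [Field K] [CharZero K]

/-- The block matrix `N_i = diag(1_{i−1}, T_i)` built from a filling `k`, where `T_i` is
upper bidiagonal with diagonal `t^{k_{i,i}}, …, t^{k_{i,r}}` and `1`s on the
superdiagonal (all indices 0-based). -/
def Nblock (K : Type*) [Field K] {r : ℕ} (k : Fin r → Fin r → ℝ) (i : Fin r) :
    Matrix (Fin r) (Fin r) (HahnSeries ℝ K) :=
  fun a b =>
    if a = b then (if i ≤ a then HahnSeries.single (k i a) 1 else 1)
    else if i ≤ a ∧ b.val = a.val + 1 then 1 else 0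

set_option linter.unusedSectionVars false

theorem inR_iff_zero_le_orderTop {a : HahnSeries ℝ K} :
    inR a ↔ ((0 : ℝ) : WithTop ℝ) ≤ a.orderTop := by
  rw [WithTop.coe_zero, HahnSeries.zero_le_orderTop_iff]
  constructor
  · rintro (rfl | h)
    · simp
    · exact h
  · exact Or.inr

/-- The valuation ring as a subring of the field of Hahn series. -/
def valuationSubring (K : Type*) [Field K] : Subring (HahnSeries ℝ K) where
  carrier := {a | 0 ≤ a.orderTop}
  mul_mem' {a b} ha hb :=
    show 0 ≤ (a * b).orderTop from
      le_trans (add_nonneg ha hb) HahnSeries.orderTop_add_le_mul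
  one_mem' := by simp
  add_mem' {a b} ha hb :=
    show 0 ≤ (a + b).orderTop from
      le_trans (le_min ha hb) HahnSeries.min_orderTop_le_orderTop_add
  zero_mem' := by simp
  neg_mem' {a} ha := by simpa using ha

theorem inR_iff_mem {a : HahnSeries ℝ K} : inR a ↔ a ∈ valuationSubring K := by
  rw [inR_iff_zero_le_orderTop, WithTop.coe_zero]
  rfl

theorem inR_single_of_nonneg {c : ℝ} (hc : 0 ≤ c) :
    inR (HahnSeries.single c (1 : K)) := by
  rw [inR_iff_zero_le_orderTop, HahnSeries.orderTop_single one_ne_zero]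
  exact_mod_cast hc

theorem prod_single_one {ι : Type*} (s : Finset ι) (f : ι → ℝ) :
    ∏ i ∈ s, HahnSeries.single (f i) (1 : K) = HahnSeries.single (∑ i ∈ s, f i) 1 := by
  classical
  induction s using Finset.induction_on with
  | empty => simp
  | insert a s ha ih => simp [Finset.prod_insert ha, Finset.sum_insert ha, ih]

/-- Multiplication by `t^{-κ}` lowers orders by `κ`. -/
theorem le_orderTop_of_single_mul {c κ : ℝ} {x y : HahnSeries ℝ K}
    (h : HahnSeries.single κ 1 * x = y) (hy : ((c + κ : ℝ) : WithTop ℝ) ≤ y.orderTop) :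
    (c : WithTop ℝ) ≤ x.orderTop := by
  have hx : x = HahnSeries.single (-κ) 1 * y := by
    rw [← h, ← mul_assoc, HahnSeries.single_mul_single]
    simp
  rw [hx]
  refine le_trans ?_ HahnSeries.orderTop_add_le_mul
  rw [HahnSeries.orderTop_single one_ne_zero]
  calc (c : WithTop ℝ) = ((-κ : ℝ) : WithTop ℝ) + ((c + κ : ℝ) : WithTop ℝ) := by
        rw [← WithTop.coe_add]; congr 1; ring
    _ ≤ _ := by gcongr

section GeneralLinear

variable {r : ℕ} {A B : Matrix (Fin r) (Fin r) (HahnSeries ℝ K)}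

theorem inR_mul_apply (hA : ∀ i j, inR (A i j)) (hB : ∀ i j, inR (B i j)) (i j : Fin r) :
    inR ((A * B) i j) := by
  simp only [inR_iff_mem, Matrix.mul_apply] at *
  exact Subring.sum_mem _ fun s _ => Subring.mul_mem _ (hA i s) (hB s j)

theorem inR_adjugate_apply (hA : ∀ i j, inR (A i j)) (i j : Fin r) :
    inR (A.adjugate i j) := by
  simp only [inR_iff_mem] at *
  let A' : Matrix (Fin r) (Fin r) (valuationSubring K) := fun i j => ⟨A i j, hA i j⟩
  have hA' : (valuationSubring K).subtype.mapMatrix A' = A := rfl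
  rw [← hA', ← RingHom.map_adjugate]
  exact (A'.adjugate i j).2

theorem inGLR_of_det_eq_one (hA : ∀ i j, inR (A i j)) (hdet : A.det = 1) : InGLR A :=
  ⟨hA, A.adjugate, inR_adjugate_apply hA, by simp [mul_adjugate, hdet],
    by simp [adjugate_mul, hdet]⟩

theorem InGLR.inv (hA : InGLR A) : InGLR A⁻¹ := by
  obtain ⟨hA, B, hB, hAB, hBA⟩ := hA
  rw [Matrix.inv_eq_right_inv hAB]
  exact ⟨hB, A, hA, hBA, hAB⟩

theorem inGLR_one : InGLR (1 : Matrix (Fin r) (Fin r) (HahnSeries ℝ K)) := by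
  refine inGLR_of_det_eq_one (fun i j => ?_) det_one
  rw [inR_iff_mem, Matrix.one_apply]
  split_ifs
  · exact Subring.one_mem _
  · exact Subring.zero_mem _

/-- A factorization `A Z = X D_ν` with `X` and `Z` of determinant one over `R` computes
the invariant of `A`. -/
theorem isInv_of_mul_eq {ν : Fin r → ℝ} (hν : Antitone ν)
    {X Z : Matrix (Fin r) (Fin r) (HahnSeries ℝ K)}
    (hX : ∀ i j, inR (X i j)) (hXdet : X.det = 1)
    (hZ : ∀ i j, inR (Z i j)) (hZdet : Z.det = 1) (h : A * Z = X * Dmat K ν) :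
    IsInv A ν := by
  refine ⟨hν, X⁻¹, Z⁻¹, (inGLR_of_det_eq_one hX hXdet).inv,
    (inGLR_of_det_eq_one hZ hZdet).inv, ?_⟩
  rw [Matrix.nonsing_inv_nonsing_inv _ (by simp [hZdet]), Matrix.mul_assoc, h,
    Matrix.nonsing_inv_mul_cancel_left _ _ (by simp [hXdet])]

end GeneralLinear

section Blocks

variable {r : ℕ} (k : Fin r → Fin r → ℝ)

theorem Nblock_apply_self (i a : Fin r) :
    Nblock K k i a a = if i ≤ a then HahnSeries.single (k i a) 1 else 1 := by
  simp [Nblock]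

theorem Nblock_mulVec_of_lt {i a : Fin r} (h : a < i) (w : Fin r → HahnSeries ℝ K) :
    (Nblock K k i *ᵥ w) a = w a := by
  rw [Matrix.mulVec, dotProduct, Finset.sum_eq_single a]
  · simp [Nblock, h.not_ge]
  · intro b _ hb
    simp [Nblock, hb.symm, h.not_ge]
  · simp

theorem Nblock_mulVec_of_le {i a b : Fin r} (h : i ≤ a) (hb : b.val = a.val + 1)
    (w : Fin r → HahnSeries ℝ K) :
    (Nblock K k i *ᵥ w) a = HahnSeries.single (k i a) 1 * w a + w b := by
  have hab : a ≠ b := by rintro rfl; omega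
  rw [Matrix.mulVec, dotProduct, Fintype.sum_eq_add a b hab]
  · simp [Nblock, h, hab, hb]
  · rintro c ⟨hca, hcb⟩
    have hc : ¬ c.val = a.val + 1 := fun hc => hcb (Fin.ext (hc.trans hb.symm))
    simp [Nblock, hca.symm, hc]

theorem Nblock_mulVec_last {i a : Fin r} (h : i ≤ a) (ha : a.val + 1 = r)
    (w : Fin r → HahnSeries ℝ K) :
    (Nblock K k i *ᵥ w) a = HahnSeries.single (k i a) 1 * w a := by
  rw [Matrix.mulVec, dotProduct, Finset.sum_eq_single a]
  · simp [Nblock, h]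
  · intro b _ hb
    have hc : ¬ b.val = a.val + 1 := by omega
    simp [Nblock, hb.symm, hc]
  · simp

theorem det_Nblock (i : Fin r) :
    (Nblock K k i).det = HahnSeries.single (∑ s ∈ Finset.Ici i, k i s) 1 := by
  rw [Matrix.det_of_isUpperTriangular]
  · simp only [Nblock_apply_self]
    rw [← prod_single_one, Finset.prod_ite, Finset.prod_const_one, mul_one]
    congr 1
    ext
    simp
  · intro a b hab
    have hab' : b < a := hab
    have hne : a ≠ b := hab'.ne'
    have hval : ¬ b.val = a.val + 1 := by omega
    simp [Nblock, hne, hval]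

theorem det_prod_Nblock :
    (((List.finRange r).map (Nblock K k)).prod).det =
      (Dmat K fun i => ∑ s ∈ Finset.Ici i, k i s).det := by
  rw [← Matrix.coe_detMonoidHom, map_list_prod, List.map_map, Matrix.coe_detMonoidHom,
    Dmat, Matrix.det_diagonal, ← List.prod_ofFn, List.ofFn_eq_map]
  congr 2
  ext1 i
  exact det_Nblock k i

variable (K) in
/-- The product of the first `n` blocks. -/
def prefixProd (n : ℕ) : Matrix (Fin r) (Fin r) (HahnSeries ℝ K) :=
  (((List.finRange r).take n).map (Nblock K k)).prod

theorem prefixProd_zero : prefixProd K k 0 = 1 := by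
  simp [prefixProd]

theorem prefixProd_succ {n : ℕ} (h : n < r) :
    prefixProd K k (n + 1) = prefixProd K k n * Nblock K k ⟨n, h⟩ := by
  rw [prefixProd, List.take_succ_eq_append_getElem (by simpa using h)]
  simp [prefixProd]

theorem prefixProd_self :
    prefixProd K k r = ((List.finRange r).map (Nblock K k)).prod := by
  rw [prefixProd, List.take_of_length_le (by simp)]

theorem inR_prefixProd_mulVec (hk : ∀ i j, i < j → 0 ≤ k i j) {n : ℕ} (hn : n ≤ r)
    (w : Fin r → HahnSeries ℝ K) (hw : ∀ s, inR (w s)) (hw0 : ∀ s : Fin r, s.val < n → w s = 0)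
    (s : Fin r) : inR ((prefixProd K k n *ᵥ w) s) := by
  induction n generalizing w with
  | zero => simpa [prefixProd_zero] using hw s
  | succ n ih =>
    have h : n < r := hn
    rw [prefixProd_succ k h, ← Matrix.mulVec_mulVec]
    have hlt : ∀ a : Fin r, a.val < n → (Nblock K k ⟨n, h⟩ *ᵥ w) a = 0 := fun a ha => by
      rw [Nblock_mulVec_of_lt k ha]
      exact hw0 a (by omega)
    refine ih h.le _ (fun a => ?_) hlt
    rcases lt_or_ge a.val n with ha | ha
    · rw [hlt a ha]; exact Or.inl rfl
    have hdiag : inR (HahnSeries.single (k ⟨n, h⟩ a) 1 * w a) := by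
      rcases ha.eq_or_lt with ha | ha
      · rw [hw0 a (by omega), mul_zero]; exact Or.inl rfl
      · have := inR_single_of_nonneg (K := K) (hk ⟨n, h⟩ a ha)
        have hwa := hw a
        rw [inR_iff_mem] at *
        exact Subring.mul_mem _ this hwa
    by_cases hr : a.val + 1 < r
    · rw [Nblock_mulVec_of_le (b := ⟨a.val + 1, hr⟩) k ha rfl]
      have hwb := hw ⟨a.val + 1, hr⟩
      rw [inR_iff_mem] at *
      exact Subring.add_mem _ hdiag hwb
    · rwa [Nblock_mulVec_last k ha (by omega)]

end Blocks

section RightFactor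

variable {r : ℕ} {k : Fin r → Fin r → ℝ}

theorem sum_Ico_of_val_eq_add_one {i a b : Fin r} (h : i ≤ a) (hb : b.val = a.val + 1)
    (f : Fin r → ℝ) :
    ∑ s ∈ Finset.Ico i b, f s = ∑ s ∈ Finset.Ico i a, f s + f a := by
  have : Finset.Ico i b = insert a (Finset.Ico i a) := by
    ext s
    simp only [Finset.mem_Ico, Finset.mem_insert, Fin.le_def, Fin.lt_def, Fin.ext_iff] at *
    omega
  rw [this, Finset.sum_insert (by simp), add_comm]

/-- Solving `N_i x = y` downwards from the last coordinate. -/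
theorem exists_Nblock_mulVec_eq {i : Fin r} (y : Fin r → HahnSeries ℝ K)
    (hy : ∀ j, i ≤ j →
      ((∑ s ∈ Finset.Ico i j, k i s + k i j : ℝ) : WithTop ℝ) ≤ (y j).orderTop) :
    ∃ x : Fin r → HahnSeries ℝ K, Nblock K k i *ᵥ x = y ∧ (∀ j, j < i → x j = y j) ∧
      ∀ j, i ≤ j → ((∑ s ∈ Finset.Ico i j, k i s : ℝ) : WithTop ℝ) ≤ (x j).orderTop := by
  have hdet : IsUnit (Nblock K k i).det := by
    rw [det_Nblock, isUnit_iff_ne_zero]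
    simp
  set x := (Nblock K k i)⁻¹ *ᵥ y with hx
  have hxy : Nblock K k i *ᵥ x = y := by
    rw [hx, Matrix.mulVec_mulVec, Matrix.mul_nonsing_inv _ hdet, Matrix.one_mulVec]
  refine ⟨x, hxy, fun j hj => by rw [← hxy, Nblock_mulVec_of_lt k hj], ?_⟩
  suffices ∀ d : ℕ, ∀ j : Fin r, j.val + d + 1 = r → i ≤ j →
      ((∑ s ∈ Finset.Ico i j, k i s : ℝ) : WithTop ℝ) ≤ (x j).orderTop from
    fun j => this (r - j.val - 1) j (by omega)
  intro d
  induction d with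
  | zero =>
    intro j hj hij
    have h := Nblock_mulVec_last k hij hj x
    rw [hxy] at h
    exact le_orderTop_of_single_mul h.symm (hy j hij)
  | succ d ih =>
    intro j hj hij
    have hr : j.val + 1 < r := by omega
    have h := Nblock_mulVec_of_le (b := ⟨j.val + 1, hr⟩) k hij rfl x
    rw [hxy, ← sub_eq_iff_eq_add] at h
    refine le_orderTop_of_single_mul h.symm ?_
    have hb := ih ⟨j.val + 1, hr⟩ (by simp only; omega)
      (Fin.le_def.2 (by simp only [Fin.le_def] at hij ⊢; omega))
    rw [sum_Ico_of_val_eq_add_one hij rfl] at hb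
    rw [sub_eq_add_neg]
    refine (le_min (hy j hij) ?_).trans HahnSeries.min_orderTop_le_orderTop_add
    rwa [HahnSeries.orderTop_neg]

/-- The vector `e_m - t^{k_{mm}} e_{m+1} + t^{k_{mm} + k_{m,m+1}} e_{m+2} - ⋯`. -/
theorem exists_Nblock_mulVec_eq_single_last (m l : Fin r) (hl : l.val + 1 = r) :
    ∃ (v : Fin r → HahnSeries ℝ K) (ε : ℤˣ),
      Nblock K k m *ᵥ v = Pi.single l (ε • HahnSeries.single (∑ s ∈ Finset.Ici m, k m s) 1) ∧
      (∀ j, j < m → v j = 0) ∧ v m = 1 ∧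
      ∀ j, m ≤ j → ((∑ s ∈ Finset.Ico m j, k m s : ℝ) : WithTop ℝ) ≤ (v j).orderTop := by
  let v : Fin r → HahnSeries ℝ K := fun j =>
    if j < m then 0 else HahnSeries.single (∑ s ∈ Finset.Ico m j, k m s) ((-1) ^ (j.val - m.val))
  have hv : ∀ j, m ≤ j → v j =
      HahnSeries.single (∑ s ∈ Finset.Ico m j, k m s) ((-1) ^ (j.val - m.val)) :=
    fun j hj => if_neg hj.not_gt
  have hml : m ≤ l := Fin.le_def.2 (by omega)
  refine ⟨v, (-1) ^ (l.val - m.val), ?_, fun j hj => if_pos hj, ?_, fun j hj => ?_⟩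
  · ext1 a
    rcases lt_or_ge a m with ha | ha
    · have hal : a ≠ l := (ha.trans_le hml).ne
      rw [Nblock_mulVec_of_lt k ha, Pi.single_eq_of_ne hal]
      exact if_pos ha
    by_cases hr : a.val + 1 < r
    · have hal : a ≠ l := by rintro rfl; omega
      have hb : m ≤ (⟨a.val + 1, hr⟩ : Fin r) :=
        Fin.le_def.2 (by simp only [Fin.le_def] at ha ⊢; omega)
      rw [Nblock_mulVec_of_le (b := ⟨a.val + 1, hr⟩) k ha rfl, Pi.single_eq_of_ne hal,
        hv a ha, hv _ hb,
        sum_Ico_of_val_eq_add_one (b := ⟨a.val + 1, hr⟩) ha rfl, HahnSeries.single_mul_single,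
        add_comm (k m a), one_mul, ← HahnSeries.single_add]
      rw [show a.val + 1 - m.val = (a.val - m.val) + 1 by simp only [Fin.le_def] at ha; omega,
        pow_succ]
      simp
    · obtain rfl : a = l := Fin.ext (by omega)
      have hI : Finset.Ici m = insert a (Finset.Ico m a) := by
        ext s
        simp only [Finset.mem_Ici, Finset.mem_Ico, Finset.mem_insert, Fin.le_def, Fin.lt_def,
          Fin.ext_iff] at *
        omega
      rw [Nblock_mulVec_last k ha hl, Pi.single_eq_same, hv a ha, HahnSeries.single_mul_single,
        hI, Finset.sum_insert (by simp), one_mul]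
      rcases Nat.even_or_odd (a.val - m.val) with h | h <;> simp [h.neg_one_pow]
  · rw [hv m le_rfl]; simp
  · rw [hv j hj, HahnSeries.orderTop_single (pow_ne_zero _ (by simp))]

/-- Solving for the blocks after `N_m` one at a time keeps the solution integral: this gives the
columns of a unitriangular right factor `Z` for which `N Z = X D_ν`. -/
theorem exists_prefixProd_mulVec_eq (hk : ∀ (i j : ℕ) (hij : i ≤ j) (hj : j + 1 < r),
      ∑ s ∈ Finset.Icc (⟨i + 1, by omega⟩ : Fin r) ⟨j + 1, hj⟩, k ⟨i + 1, by omega⟩ s ≤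
        ∑ s ∈ Finset.Icc (⟨i, by omega⟩ : Fin r) ⟨j, by omega⟩, k ⟨i, by omega⟩ s)
    {m n : ℕ} (hm : m < r) (hmn : m ≤ n) (hn : n < r) (y : Fin r → HahnSeries ℝ K)
    (v : Fin r → HahnSeries ℝ K)
    (hv0 : ∀ j : Fin r, j.val < m → v j = 0) (hv1 : v ⟨m, hm⟩ = 1)
    (hv : ∀ j : Fin r, m ≤ j.val →
      ((∑ s ∈ Finset.Ico ⟨m, hm⟩ j, k ⟨m, hm⟩ s : ℝ) : WithTop ℝ) ≤ (v j).orderTop)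
    (hvy : prefixProd K k (m + 1) *ᵥ v = y) :
    ∃ z : Fin r → HahnSeries ℝ K, prefixProd K k (n + 1) *ᵥ z = y ∧
      (∀ j : Fin r, j.val < m → z j = 0) ∧ z ⟨m, hm⟩ = 1 ∧
      (∀ j : Fin r, j.val ≤ n → inR (z j)) ∧
      ∀ j : Fin r, n ≤ j.val →
        ((∑ s ∈ Finset.Ico ⟨n, hn⟩ j, k ⟨n, hn⟩ s : ℝ) : WithTop ℝ) ≤ (z j).orderTop := by
  induction n, hmn using Nat.le_induction with
  | base =>
    refine ⟨v, hvy, hv0, hv1, fun j hj => ?_, hv⟩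
    rcases hj.lt_or_eq with h | h
    · exact Or.inl (hv0 j h)
    · obtain rfl : j = ⟨m, hn⟩ := Fin.ext h
      rw [hv1, inR_iff_mem]
      exact Subring.one_mem _
  | succ n hmn ih =>
    obtain ⟨z, hz, hz0, hz1, hzR, hzo⟩ := ih (by omega)
    obtain ⟨x, hx, hxlt, hxo⟩ := exists_Nblock_mulVec_eq (k := k) (i := ⟨n + 1, hn⟩) z
      (fun j hj => by
        have hj' : n + 1 ≤ j.val := hj
        refine le_trans ?_ (hzo j (by omega))
        have h := hk n (j.val - 1) (by omega) (by omega)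
        have h1 : (⟨j.val - 1 + 1, by omega⟩ : Fin r) = j := Fin.ext (by simp only; omega)
        have h2 : Finset.Icc (⟨n + 1, hn⟩ : Fin r) j = insert j (Finset.Ico ⟨n + 1, hn⟩ j) := by
          ext s
          simp only [Finset.mem_Icc, Finset.mem_Ico, Finset.mem_insert, Fin.le_def, Fin.lt_def,
            Fin.ext_iff]
          omega
        have h3 : Finset.Icc (⟨n, by omega⟩ : Fin r) ⟨j.val - 1, by omega⟩ =
            Finset.Ico ⟨n, by omega⟩ j := by
          ext s
          simp only [Finset.mem_Icc, Finset.mem_Ico, Fin.le_def, Fin.lt_def]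
          omega
        rw [h1, h2, h3, Finset.sum_insert (by simp), add_comm] at h
        exact_mod_cast h)
    have hxz : ∀ j : Fin r, j.val ≤ n → x j = z j := fun j hj =>
      hxlt j (Fin.lt_def.2 (by simp only; omega))
    refine ⟨x, ?_, fun j hj => ?_, ?_, fun j hj => ?_, hxo⟩
    · rw [prefixProd_succ k hn, ← Matrix.mulVec_mulVec, hx, hz]
    · rw [hxz j (by omega), hz0 j hj]
    · rw [hxz _ (by simpa using hmn), hz1]
    · rcases hj.lt_or_eq with h | h
      · rw [hxz j (by omega)]
        exact hzR j (by omega)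
      · obtain rfl : j = ⟨n + 1, hn⟩ := Fin.ext h
        rw [inR_iff_zero_le_orderTop]
        simpa using hxo _ le_rfl

theorem isInv_prod_Nblock {ν : Fin r → ℝ} (hν : Antitone ν)
    (hkν : ∀ i, ∑ s ∈ Finset.Ici i, k i s = ν i) (hpos : ∀ i j, i < j → 0 ≤ k i j)
    (hk : ∀ (i j : ℕ) (hij : i ≤ j) (hj : j + 1 < r),
      ∑ s ∈ Finset.Icc (⟨i + 1, by omega⟩ : Fin r) ⟨j + 1, hj⟩, k ⟨i + 1, by omega⟩ s ≤
        ∑ s ∈ Finset.Icc (⟨i, by omega⟩ : Fin r) ⟨j, by omega⟩, k ⟨i, by omega⟩ s) :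
    IsInv (((List.finRange r).map (Nblock K k)).prod) ν := by
  set N := ((List.finRange r).map (Nblock K k)).prod with hN
  have key : ∀ m : Fin r, ∃ z x : Fin r → HahnSeries ℝ K,
      N *ᵥ z = (fun a => x a * HahnSeries.single (ν m) 1) ∧ (∀ j, j < m → z j = 0) ∧ z m = 1 ∧
        (∀ j, inR (z j)) ∧ ∀ j, inR (x j) := by
    intro m
    have hl : r - 1 < r := Nat.sub_one_lt (Fin.pos m).ne'
    set l : Fin r := ⟨r - 1, hl⟩ with hl_def
    obtain ⟨v, ε, hv, hv0, hv1, hvo⟩ :=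
      exists_Nblock_mulVec_eq_single_last (K := K) (k := k) m l (by simp only [hl_def]; omega)
    obtain ⟨z, hz, hz0, hz1, hzR, -⟩ :=
      exists_prefixProd_mulVec_eq hk (m := m.val) (n := r - 1) m.2 (by omega) hl _ v
        (fun j hj => hv0 j hj) hv1 hvo rfl
    refine ⟨z, prefixProd K k m.val *ᵥ Pi.single l (ε • 1), ?_, fun j hj => hz0 j hj, hz1,
      fun j => hzR j (by omega), inR_prefixProd_mulVec k hpos m.2.le _ (fun s => ?_)
        fun s hs => Pi.single_eq_of_ne ?_ _⟩
    · rw [hN, ← prefixProd_self]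
      rw [show r - 1 + 1 = r by omega] at hz
      rw [hz, prefixProd_succ k m.2, ← Matrix.mulVec_mulVec, hv, hkν]
      ext1 a
      simp [Matrix.mulVec_single, smul_mul_assoc]
    · rw [inR_iff_mem]
      by_cases hs : s = l
      · rw [hs, Pi.single_eq_same]
        rcases Int.units_eq_one_or ε with rfl | rfl
        · simp
        · simp
      · rw [Pi.single_eq_of_ne hs]
        exact Subring.zero_mem _
    · rintro rfl
      simp only [hl_def] at hs
      omega
  choose z x hzx hz0 hz1 hzR hxR using key
  set Z : Matrix (Fin r) (Fin r) (HahnSeries ℝ K) := Matrix.of fun a m => z m a with hZ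
  set X : Matrix (Fin r) (Fin r) (HahnSeries ℝ K) := Matrix.of fun a m => x m a with hX
  have hZdet : Z.det = 1 := by
    rw [Matrix.det_of_isLowerTriangular]
    · simp [hZ, hz1]
    · intro a m ham
      exact hz0 m a ham
  have hmul : N * Z = X * Dmat K ν := by
    ext1 a m
    rw [Dmat, Matrix.mul_diagonal]
    exact congrFun (hzx m) a
  have hXdet : X.det = 1 := by
    have h := congrArg Matrix.det hmul
    have hD : (Dmat K ν).det ≠ 0 := by
      simp [Dmat, Matrix.det_diagonal, Finset.prod_ne_zero_iff]
    rw [Matrix.det_mul, Matrix.det_mul, hZdet, hN, det_prod_Nblock, funext hkν, mul_one] at h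
    exact (mul_eq_right₀ hD).1 h.symm
  exact isInv_of_mul_eq hν (fun i j => hxR j i) hXdet (fun i j => hzR j i) hZdet hmul

end RightFactor

section LeftFactor

variable {r : ℕ} {k : Fin r → Fin r → ℝ}

theorem exists_Dmat_mul_Nblock_eq (i : Fin r) (α β : Fin r → ℝ)
    (hlt : ∀ j, j < i → β j = α j) (hle : ∀ j, i ≤ j → β j = α j + k i j)
    (hαβ : ∀ a b : Fin r, i ≤ a → b.val = a.val + 1 → β b ≤ α a) :
    ∃ P : Matrix (Fin r) (Fin r) (HahnSeries ℝ K), (∀ a b, inR (P a b)) ∧ P.det = 1 ∧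
      Dmat K α * Nblock K k i = P * Dmat K β := by
  let P : Matrix (Fin r) (Fin r) (HahnSeries ℝ K) := Matrix.of fun a b =>
    if a = b then 1
    else if i ≤ a ∧ b.val = a.val + 1 then HahnSeries.single (α a - β b) 1 else 0
  refine ⟨P, fun a b => ?_, ?_, ?_⟩
  · simp only [P, Matrix.of_apply]
    split_ifs with h1 h2
    · exact inR_iff_mem.2 (Subring.one_mem _)
    · exact inR_single_of_nonneg (sub_nonneg.2 (hαβ a b h2.1 h2.2))
    · exact Or.inl rfl
  · rw [Matrix.det_of_isUpperTriangular]
    · simp [P]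
    · intro a b hab
      have hab' : b < a := hab
      have hval : ¬ b.val = a.val + 1 := by omega
      simp [P, hab'.ne', hval]
  · ext1 a b
    rw [Dmat, Dmat, Matrix.diagonal_mul, Matrix.mul_diagonal]
    simp only [P, Matrix.of_apply, Nblock]
    split_ifs with h1 h2 h3
    · subst h1
      simp [hle a h2]
    · subst h1
      simp [hlt a (not_le.1 h2)]
    · simp
    · simp

theorem isInv_Dmat_mul_prod_Nblock {μ lam : Fin r → ℝ} (hlam : Antitone lam)
    (hk : ∀ j : Fin r, μ j + ∑ s ∈ Finset.Iic j, k s j = lam j)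
    (hkμ : ∀ (i j : ℕ) (hi : i < r) (hj : j < r), i ≤ j → 1 ≤ j →
      μ ⟨j, hj⟩ + ∑ s ∈ Finset.Iic (⟨i, hi⟩ : Fin r), k s ⟨j, hj⟩ ≤
        μ ⟨j - 1, by omega⟩ + ∑ s ∈ Finset.Iio (⟨i, hi⟩ : Fin r), k s ⟨j - 1, by omega⟩) :
    IsInv (Dmat K μ * ((List.finRange r).map (Nblock K k)).prod) lam := by
  let γ : ℕ → Fin r → ℝ := fun n j =>
    μ j + ∑ s ∈ Finset.univ.filter (fun s : Fin r => s.val < n ∧ s ≤ j), k s j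
  have key : ∀ n, n ≤ r → ∃ P : Matrix (Fin r) (Fin r) (HahnSeries ℝ K),
      (∀ a b, inR (P a b)) ∧ P.det = 1 ∧ Dmat K μ * prefixProd K k n = P * Dmat K (γ n) := by
    intro n
    induction n with
    | zero =>
      intro _
      refine ⟨1, inGLR_one.1, det_one, ?_⟩
      simp [prefixProd_zero, γ]
    | succ n ih =>
      intro hn
      obtain ⟨P, hP, hPdet, hPeq⟩ := ih (by omega)
      have h : n < r := hn
      obtain ⟨P', hP', hP'det, hP'eq⟩ := exists_Dmat_mul_Nblock_eq (K := K) (k := k) ⟨n, h⟩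
        (γ n) (γ (n + 1))
        (fun j hj => by
          simp only [γ]
          congr 2
          ext s
          simp only [Finset.mem_filter, Finset.mem_univ, true_and, Fin.lt_def, Fin.le_def] at *
          omega)
        (fun j hj => by
          have : Finset.univ.filter (fun s : Fin r => s.val < n + 1 ∧ s ≤ j) =
              insert ⟨n, h⟩ (Finset.univ.filter (fun s : Fin r => s.val < n ∧ s ≤ j)) := by
            ext s
            simp only [Finset.mem_filter, Finset.mem_univ, true_and, Fin.le_def,
              Finset.mem_insert, Fin.ext_iff] at *
            omega
          simp only [γ]
          rw [this, Finset.sum_insert (by simp)]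
          ring)
        (fun a b ha hb => by
          have ha' : n ≤ a.val := ha
          have h1 := hkμ n b.val h b.2 (by omega) (by omega)
          have h2 : (⟨b.val - 1, by omega⟩ : Fin r) = a := Fin.ext (by simp only; omega)
          rw [h2] at h1
          simp only [γ]
          convert h1 using 3
          · ext s
            simp only [Finset.mem_filter, Finset.mem_univ, true_and, Fin.le_def,
              Finset.mem_Iic]
            omega
          · ext s
            simp only [Finset.mem_filter, Finset.mem_univ, true_and, Fin.le_def, Fin.lt_def,
              Finset.mem_Iio]
            omega)
      refine ⟨P * P', inR_mul_apply hP hP', by rw [det_mul, hPdet, hP'det, one_mul], ?_⟩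
      rw [prefixProd_succ k h, ← Matrix.mul_assoc, hPeq, Matrix.mul_assoc, hP'eq,
        Matrix.mul_assoc]
  obtain ⟨P, hP, hPdet, hPeq⟩ := key r le_rfl
  have hγ : γ r = lam := by
    ext1 j
    rw [← hk j]
    simp only [γ]
    congr 2
    ext s
    simp
  rw [prefixProd_self, hγ] at hPeq
  exact isInv_of_mul_eq hlam hP hPdet inGLR_one.1 det_one (by rw [Matrix.mul_one, hPeq])

end LeftFactor

/-- From an `L𝕉` filling of type `(μ, ν; λ)` one constructs matrices
`M = D_μ` and `N = N_1 N_2 ⋯ N_r` with `inv(M) = μ`, `inv(N) = ν` and `inv(MN) = λ`. -/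
theorem filling_to_matrices {r : ℕ} (μ ν lam : Fin r → ℝ)
    (hμ : Antitone μ) (hν : Antitone ν) (hlam : Antitone lam)
    (hsum : (∑ i, μ i) + ∑ i, ν i = ∑ i, lam i)
    (k : Fin r → Fin r → ℝ) (hk : IsLRFilling μ ν lam k) :
    IsInv (Dmat K μ) μ ∧
    IsInv (((List.finRange r).map (Nblock K k)).prod) ν ∧
    IsInv (Dmat K μ * ((List.finRange r).map (Nblock K k)).prod) lam := by
  obtain ⟨hkl, hkν, hpos, hkμ, hk'⟩ := hk
  exact ⟨isInv_of_mul_eq hμ inGLR_one.1 det_one inGLR_one.1 det_one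
      (by rw [Matrix.mul_one, Matrix.one_mul]),
    isInv_prod_Nblock hν hkν hpos hk', isInv_Dmat_mul_prod_Nblock hlam hkl hkμ⟩

end
end

section
/- Let (M,N) ∈ M_r(𝓕)² be a full-rank pair with inv(M) = μ, inv(N) = ν, inv(MN) = λ, and right filling {k_ij}. Let α ∈ ℝ and D(α) = diag(t^α, …, t^α). Let {k*_ij} be the right filling of the pair (M, N·D(α)). Then k*_ij = k_ij for all i < j, and k*_ii = k_ii + α for all 1 ≤ i ≤ r. -/
open Matrix HahnSeries

noncomputable section

variable {K : Type*} [Field K] [CharZero K]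

lemma exists_le_perm_apply_le {n : ℕ} (π : Equiv.Perm (Fin n)) (s : Fin n) :
    ∃ y, s ≤ y ∧ π y ≤ s := by
  by_contra! h
  have hsub : (Finset.Ici s).map π.toEmbedding ⊆ Finset.Ioi s := by
    intro x hx
    obtain ⟨y, hy, rfl⟩ := Finset.mem_map.mp hx
    exact Finset.mem_Ioi.mpr (h y (Finset.mem_Ici.mp hy))
  have hcard := Finset.card_le_card hsub
  rw [Finset.card_map, Fin.card_Ici, Fin.card_Ioi] at hcard
  have := s.isLt
  omega

/-- Matching two increasing families in order minimises `∑ μ (min _ _)` for antitone `μ`. -/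
lemma sum_min_le_sum_min_comp_perm {r n : ℕ} {μ : Fin r → ℝ} (hμ : Antitone μ)
    {I H : Fin n → Fin r} (hI : Monotone I) (hH : Monotone H) (π : Equiv.Perm (Fin n)) :
    ∑ s, μ (min (I s) (H s)) ≤ ∑ s, μ (min (I (π s)) (H s)) := by
  set g : Fin n → Fin r := fun s => min (I (π s)) (H s) with hg
  rw [← Equiv.sum_comp (Tuple.sort g) fun s => μ (g s)]
  refine Finset.sum_le_sum fun s _ => hμ (le_min ?_ ?_)
  · obtain ⟨y, hsy, hy⟩ := exists_le_perm_apply_le ((Tuple.sort g).trans π) s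
    exact (Tuple.monotone_sort g hsy).trans ((min_le_left _ _).trans (hI hy))
  · obtain ⟨y, hsy, hy⟩ := exists_le_perm_apply_le (Tuple.sort g) s
    exact (Tuple.monotone_sort g hsy).trans ((min_le_right _ _).trans (hH hy))

lemma le_lastCols {r n : ℕ} (h : n ≤ r) {J : Fin n → Fin r} (hJ : StrictMono J) (s : Fin n) :
    J s ≤ lastCols r n h s := by
  have hsub : (Finset.Ioi s).map ⟨J, hJ.injective⟩ ⊆ Finset.Ioi (J s) := by
    intro x hx
    obtain ⟨y, hy, rfl⟩ := Finset.mem_map.mp hx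
    exact Finset.mem_Ioi.mpr (hJ (Finset.mem_Ioi.mp hy))
  have hcard := Finset.card_le_card hsub
  rw [Finset.card_map, Fin.card_Ioi, Fin.card_Ioi] at hcard
  have h₁ := s.isLt
  have h₂ := (J s).isLt
  rw [Fin.le_def]
  simp only [lastCols]
  omega

lemma strictMono_lastCols {r n : ℕ} (h : n ≤ r) : StrictMono (lastCols r n h) := by
  intro a b hab
  rw [Fin.lt_def] at hab ⊢
  simp only [lastCols]
  omega

section Minors

variable {F : Type*} [Field F] {r n : ℕ}

lemma det_mul_submatrix {R : Type*} [CommRing R] (A B : Matrix (Fin r) (Fin r) R)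
    (H J : Fin n → Fin r) :
    ((A * B).submatrix H J).det =
      ∑ f : Fin n → Fin r, (∏ s, A (H s) (f s)) * (B.submatrix f J).det := by
  have h : (A * B).submatrix H J = fun s => ∑ j, A (H s) j • fun t => B j (J t) := by
    ext s t
    simp [Matrix.mul_apply, Finset.sum_apply]
  have hsum := (Matrix.detRowAlternating (n := Fin n) (R := R)).toMultilinearMap.map_sum
    fun s j => A (H s) j • fun t => B j (J t)
  rw [h]
  refine hsum.trans (Finset.sum_congr rfl fun f _ => ?_)
  exact (Matrix.detRowAlternating (n := Fin n) (R := R)).toMultilinearMap.map_smul_univ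
    (fun s => A (H s) (f s)) fun s t => B (f s) (J t)

/-- A lower bound on the valuation of every term of the Cauchy–Binet expansion bounds the
valuation of a minor of a product. -/
lemma le_addVal_minorDet_mul (A B : Matrix (Fin r) (Fin r) (HahnSeries ℝ F))
    (H J : Fin n → Fin r) (c : WithTop ℝ)
    (hc : ∀ f : Fin n → Fin r, Function.Injective f →
      c ≤ addVal ℝ F (∏ s, A (H s) (f s)) + addVal ℝ F (minorDet B f J)) :
    c ≤ addVal ℝ F (minorDet (A * B) H J) := by
  rw [minorDet, det_mul_submatrix]
  refine AddValuation.map_le_sum _ fun f _ => ?_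
  by_cases hf : Function.Injective f
  · rw [AddValuation.map_mul]
    exact hc f hf
  · obtain ⟨a, b, hab, hne⟩ : ∃ a b, f a = f b ∧ a ≠ b := by
      simpa [Function.Injective] using hf
    rw [Matrix.det_zero_of_row_eq hne (funext fun t => by simp [hab])]
    simp

lemma minorDet_transpose (B : Matrix (Fin r) (Fin r) (HahnSeries ℝ F)) (H J : Fin n → Fin r) :
    minorDet Bᵀ H J = minorDet B J H := by
  rw [minorDet, ← Matrix.transpose_submatrix, Matrix.det_transpose, minorDet]

lemma addVal_minorDet_comp_perm (B : Matrix (Fin r) (Fin r) (HahnSeries ℝ F))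
    (I J : Fin n → Fin r) (π : Equiv.Perm (Fin n)) :
    addVal ℝ F (minorDet B (I ∘ π) J) = addVal ℝ F (minorDet B I J) := by
  have h : B.submatrix (I ∘ π) J = (B.submatrix I J).submatrix π id := rfl
  rw [minorDet, h, Matrix.det_permute, minorDet]
  rcases Int.units_eq_one_or (Equiv.Perm.sign π) with h | h <;> simp [h, AddValuation.map_neg]

lemma exists_strictMono_comp_perm {f : Fin n → Fin r} (hf : Function.Injective f) :
    ∃ (I : Fin n → Fin r) (π : Equiv.Perm (Fin n)), StrictMono I ∧ f = I ∘ π := by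
  refine ⟨f ∘ Tuple.sort f, (Tuple.sort f).symm, ?_, ?_⟩
  · exact (Tuple.monotone_sort f).strictMono_of_injective (hf.comp (Tuple.sort f).injective)
  · ext s
    simp

lemma le_addVal_prod {f : Fin n → HahnSeries ℝ F} {w : Fin n → ℝ}
    (h : ∀ s, (w s : WithTop ℝ) ≤ addVal ℝ F (f s)) :
    ((∑ s, w s : ℝ) : WithTop ℝ) ≤ addVal ℝ F (∏ s, f s) := by
  induction n with
  | zero => simp
  | succ n ih =>
    rw [Fin.sum_univ_succ, Fin.prod_univ_succ, AddValuation.map_mul, WithTop.coe_add]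
    exact add_le_add (h 0) (ih fun s => h s.succ)

/-- Right multiplication by a matrix with entries of valuation at least `α` raises the lower
bound for the minors on `n` given rows by `n * α`. -/
lemma le_addVal_minorDet_mul_right (C S : Matrix (Fin r) (Fin r) (HahnSeries ℝ F)) {α : ℝ}
    (hS : ∀ i j, (α : WithTop ℝ) ≤ addVal ℝ F (S i j)) (H L : Fin n → Fin r) (c : WithTop ℝ)
    (hc : ∀ J : Fin n → Fin r, StrictMono J → c ≤ addVal ℝ F (minorDet C H J)) :
    ((n * α : ℝ) : WithTop ℝ) + c ≤ addVal ℝ F (minorDet (C * S) H L) := by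
  rw [← minorDet_transpose, Matrix.transpose_mul]
  refine le_addVal_minorDet_mul _ _ _ _ _ fun f hf => add_le_add ?_ ?_
  · have := le_addVal_prod (f := fun s => Sᵀ (L s) (f s)) (w := fun _ => α)
      fun s => hS (f s) (L s)
    simpa using this
  · obtain ⟨J, π, hJ, rfl⟩ := exists_strictMono_comp_perm hf
    rw [addVal_minorDet_comp_perm, minorDet_transpose]
    exact hc J hJ

lemma minorDet_eq_zero_of_lt {B : Matrix (Fin r) (Fin r) (HahnSeries ℝ F)}
    (hB : ∀ i j : Fin r, j < i → B i j = 0) {I J : Fin n → Fin r} (hI : Monotone I)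
    (hJ : Monotone J) {s : Fin n} (hs : J s < I s) : minorDet B I J = 0 := by
  rw [minorDet, Matrix.det_apply]
  refine Finset.sum_eq_zero fun π _ => ?_
  obtain ⟨y, hsy, hy⟩ := exists_le_perm_apply_le π.symm s
  have hz : B (I y) (J (π.symm y)) = 0 := hB _ _ ((hJ hy).trans_lt (hs.trans_le (hI hsy)))
  rw [Finset.prod_eq_zero (Finset.mem_univ (π.symm y)) (by simpa using hz), smul_zero]

/-- Left multiplication by a `μ`-admissible matrix does not lower the valuation of the minors of
a `μ`-generic matrix below that of the minor on the same rows and the rightmost columns. -/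
lemma MuGeneric.addVal_le_minorDet_mul {μ : Fin r → ℝ} (hμ : Antitone μ)
    {B Q : Matrix (Fin r) (Fin r) (HahnSeries ℝ F)} (hB : MuGeneric μ B)
    (hQ : ∀ i j, (0 : WithTop ℝ) ≤ addVal ℝ F (Q i j))
    (hQμ : ∀ i j, ((μ j - μ i : ℝ) : WithTop ℝ) ≤ addVal ℝ F (Q i j))
    (hn : n ≤ r) {H J : Fin n → Fin r} (hH : StrictMono H) (hJ : StrictMono J) :
    addVal ℝ F (minorDet B H (lastCols r n hn)) ≤ addVal ℝ F (minorDet (Q * B) H J) := by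
  refine le_addVal_minorDet_mul _ _ _ _ _ fun f hf => ?_
  obtain ⟨I, π, hI, rfl⟩ := exists_strictMono_comp_perm hf
  rw [addVal_minorDet_comp_perm]
  by_cases hIJ : ∀ s, I s ≤ J s
  swap
  · push Not at hIJ
    obtain ⟨s, hs⟩ := hIJ
    rw [minorDet_eq_zero_of_lt hB.2.1 hI.monotone hJ.monotone hs]
    simp
  have hprod := le_addVal_prod (f := fun s => Q (H s) ((I ∘ π) s))
    (w := fun s => μ (min (I (π s)) (H s)) - μ (H s)) fun s => by
      rcases le_total (I (π s)) (H s) with h | h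
      · rw [min_eq_left h]
        exact hQμ _ _
      · rw [min_eq_right h, sub_self]
        exact hQ _ _
  have hmin := sum_min_le_sum_min_comp_perm hμ hI.monotone hH.monotone π
  have hK : StrictMono fun s => min (I s) (H s) := fun a b hab =>
    lt_min ((min_le_left _ _).trans_lt (hI hab)) ((min_le_right _ _).trans_lt (hH hab))
  have hL := strictMono_lastCols hn
  obtain ⟨-, hHL, -, -, hle, -⟩ := hB.2.2 n _ H _ hK hH hL (fun s => min_le_right _ _)
    (le_lastCols hn hH)
  obtain ⟨-, -, hIJ0, -, -, hcol⟩ := hB.2.2 n I J _ hI hJ hL hIJ (le_lastCols hn hJ)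
  obtain ⟨-, -, -, hrow, -, -⟩ := hB.2.2 n _ I _ hK hI hL (fun s => min_le_left _ _)
    (le_lastCols hn hI)
  refine le_trans ?_ (add_le_add_left hprod _)
  rw [addVal_apply_of_ne hHL, addVal_apply_of_ne hIJ0, ← WithTop.coe_add, WithTop.coe_le_coe,
    Finset.sum_sub_distrib]
  linarith

end Minors

section Equivalence

variable {F : Type*} [Field F] {r : ℕ}

lemma inR_iff {a : HahnSeries ℝ F} : inR a ↔ (0 : WithTop ℝ) ≤ addVal ℝ F a := by
  by_cases ha : a = 0
  · simp [inR, ha]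
  · rw [inR, addVal_apply_of_ne ha, ← WithTop.coe_zero, WithTop.coe_le_coe]
    simp [ha]

lemma InGLR.isUnit_det {P : Matrix (Fin r) (Fin r) (HahnSeries ℝ F)} (hP : InGLR P) :
    IsUnit P.det := by
  obtain ⟨-, N, -, h, -⟩ := hP
  exact Matrix.isUnit_det_of_right_inverse h

lemma InGLR.inv_s16 {P : Matrix (Fin r) (Fin r) (HahnSeries ℝ F)} (hP : InGLR P) : InGLR P⁻¹ := by
  obtain ⟨hP₁, N, hN, h₁, h₂⟩ := hP
  rw [Matrix.inv_eq_right_inv h₁]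
  exact ⟨hN, P, hP₁, h₂, h₁⟩

lemma addVal_mul_nonneg {P Q : Matrix (Fin r) (Fin r) (HahnSeries ℝ F)} (hP : InGLR P)
    (hQ : InGLR Q) (i j : Fin r) : (0 : WithTop ℝ) ≤ addVal ℝ F ((P * Q) i j) := by
  rw [Matrix.mul_apply]
  refine AddValuation.map_le_sum _ fun s _ => ?_
  rw [AddValuation.map_mul]
  exact add_nonneg (inR_iff.mp (hP.1 _ _)) (inR_iff.mp (hQ.1 _ _))

lemma addVal_single_one (a : ℝ) : addVal ℝ F (single a 1) = (a : WithTop ℝ) := by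
  rw [addVal_apply, orderTop_single one_ne_zero]

lemma Dmat_const (α : ℝ) :
    Dmat F (fun _ : Fin r => α) = single α (1 : F) • (1 : Matrix (Fin r) (Fin r) _) := by
  rw [Dmat, Matrix.smul_one_eq_diagonal]

/-- Replacing `N` by `N * D(α)` raises the valuations of the minors of a generic representative on
`n` rows and the rightmost columns by at least `n * α`. -/
lemma addVal_minorDet_lastCols_shift_le {μ : Fin r → ℝ} (hμ : Antitone μ) {α : ℝ}
    {M N B B' : Matrix (Fin r) (Fin r) (HahnSeries ℝ F)} (hB : MuGeneric μ B)
    (hE : PairEquiv M N (Dmat F μ) B)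
    (hE' : PairEquiv M (N * Dmat F fun _ => α) (Dmat F μ) B') {n : ℕ} (hn : n ≤ r)
    {H : Fin n → Fin r} (hH : StrictMono H) :
    ((n * α : ℝ) : WithTop ℝ) + addVal ℝ F (minorDet B H (lastCols r n hn)) ≤
      addVal ℝ F (minorDet B' H (lastCols r n hn)) := by
  obtain ⟨P, Q, T, hP, hQ, hT, hD, rfl⟩ := hE
  obtain ⟨P', Q', T', hP', hQ', hT', hD', rfl⟩ := hE'
  have hfac : Q' * (N * Dmat F fun _ => α) * T'⁻¹ =
      Q' * Q⁻¹ * (Q * N * T⁻¹) * (single α (1 : F) • (T * T'⁻¹)) := by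
    rw [Dmat_const]
    simp only [Matrix.mul_smul, Matrix.smul_mul, Matrix.mul_one]
    congr 1
    simp only [Matrix.mul_assoc, Matrix.nonsing_inv_mul_cancel_left _ _ hQ.isUnit_det,
      Matrix.nonsing_inv_mul_cancel_left _ _ hT.isUnit_det]
  have hcomm : Dmat F μ * (Q' * Q⁻¹) = P' * P⁻¹ * Dmat F μ := by
    conv_lhs => rw [hD']
    rw [hD]
    simp only [Matrix.mul_assoc, Matrix.nonsing_inv_mul_cancel_left _ _ hQ'.isUnit_det,
      Matrix.nonsing_inv_mul_cancel_left _ _ hP.isUnit_det]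
  rw [hfac]
  refine le_addVal_minorDet_mul_right _ _ (fun i j => ?_) _ _ _ fun J hJ =>
    hB.addVal_le_minorDet_mul hμ (addVal_mul_nonneg hQ' hQ.inv_s16) (fun i j => ?_) hn hH hJ
  · rw [Matrix.smul_apply, smul_eq_mul, AddValuation.map_mul, addVal_single_one]
    exact le_add_of_nonneg_right (addVal_mul_nonneg hT hT'.inv_s16 i j)
  · have hij := congrArg (addVal ℝ F) (congrFun (congrFun hcomm i) j)
    rw [Dmat, Matrix.diagonal_mul, Matrix.mul_diagonal, AddValuation.map_mul,
      AddValuation.map_mul, addVal_single_one, addVal_single_one] at hij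
    have hnonneg := addVal_mul_nonneg hP' hP.inv_s16 i j
    generalize addVal ℝ F ((P' * P⁻¹) i j) = p at hij hnonneg
    generalize addVal ℝ F ((Q' * Q⁻¹) i j) = q at hij ⊢
    induction q with
    | top => exact le_top
    | coe q =>
      induction p with
      | top => simp [← WithTop.coe_add] at hij
      | coe p =>
        norm_cast at hij hnonneg ⊢
        linarith

lemma PairEquiv.mul_Dmat_neg {μ : Fin r → ℝ} {α : ℝ}
    {M N B : Matrix (Fin r) (Fin r) (HahnSeries ℝ F)} (hE : PairEquiv M N (Dmat F μ) B) :
    PairEquiv M (N * (Dmat F fun _ => α) * Dmat F fun _ => -α) (Dmat F μ) B := by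
  have h : (Dmat F fun _ : Fin r => α) * (Dmat F fun _ => -α) = 1 := by
    simp [Dmat, Matrix.diagonal_mul_diagonal, HahnSeries.single_mul_single]
  rwa [Matrix.mul_assoc, h, Matrix.mul_one]

lemma hatOrd_shift {μ : Fin r → ℝ} (hμ : Antitone μ) {α : ℝ}
    {M N B B' : Matrix (Fin r) (Fin r) (HahnSeries ℝ F)} (hB : MuGeneric μ B)
    (hB' : MuGeneric μ B') (hE : PairEquiv M N (Dmat F μ) B)
    (hE' : PairEquiv M (N * Dmat F fun _ => α) (Dmat F μ) B') (p q : ℕ) :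
    hatOrd B' p q = (keptRows r p q).card * α + hatOrd B p q := by
  have hH : StrictMono fun i => ((keptRows r p q).orderIsoOfFin rfl i).1 :=
    fun a b hab => ((keptRows r p q).orderIsoOfFin rfl).strictMono hab
  have hn := keptRows_card_le r p q
  have hL := strictMono_lastCols hn
  obtain ⟨h₀, -⟩ := hB.2.2 _ _ _ _ hH hH hL (fun _ => le_rfl) (le_lastCols hn hH)
  obtain ⟨h₀', -⟩ := hB'.2.2 _ _ _ _ hH hH hL (fun _ => le_rfl) (le_lastCols hn hH)
  have h₁ := addVal_minorDet_lastCols_shift_le hμ hB hE hE' hn hH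
  have h₂ := addVal_minorDet_lastCols_shift_le hμ hB' hE' (hE.mul_Dmat_neg (α := α)) hn hH
  rw [addVal_apply_of_ne h₀, addVal_apply_of_ne h₀', ← WithTop.coe_add, WithTop.coe_le_coe]
    at h₁ h₂
  rw [hatOrd, hatOrd]
  linarith

end Equivalence

lemma keptRows_card (r p q : ℕ) (hq : q ≤ r) : (keptRows r p q).card = r - (q - (p - 1)) := by
  have h : (Finset.univ.filter fun x : Fin r => p ≤ x.val + 1 ∧ x.val + 1 ≤ q).card =
      (Finset.Ico (p - 1) q).card := by
    refine Finset.card_bij (fun x _ => x.val) (fun x hx => ?_) (fun x _ y _ h => Fin.ext h)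
      fun y hy => ?_
    · simp only [Finset.mem_filter, Finset.mem_univ, true_and, Finset.mem_Ico] at hx ⊢
      omega
    · rw [Finset.mem_Ico] at hy
      refine ⟨⟨y, by omega⟩, ?_, rfl⟩
      simp only [Finset.mem_filter, Finset.mem_univ, true_and]
      omega
  rw [keptRows, Finset.card_compl, Fintype.card_fin, h, Nat.card_Ico]

lemma sum_Iic_shift {F : Type*} [Field F] {r : ℕ} {μ : Fin r → ℝ} (hμ : Antitone μ) {α : ℝ}
    {M N : Matrix (Fin r) (Fin r) (HahnSeries ℝ F)} {k kstar : Fin r → Fin r → ℝ}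
    (hk : RightFillingOf μ M N k)
    (hkstar : RightFillingOf μ M (N * Dmat F fun _ => α) kstar) {i j : Fin r} (hij : i ≤ j) :
    ∑ s ∈ Finset.Iic i, kstar s j =
      ∑ s ∈ Finset.Iic i, k s j + if i = j then α else 0 := by
  obtain ⟨B, hB, hE, hsum⟩ := hk
  obtain ⟨B', hB', hE', hsum'⟩ := hkstar
  have hj := j.isLt
  rw [hsum i j hij, hsum' i j hij, hatOrd_shift hμ hB hB' hE hE', hatOrd_shift hμ hB hB' hE hE',
    keptRows_card _ _ _ (by omega), keptRows_card _ _ _ (by omega)]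
  rw [Fin.le_def] at hij
  split_ifs with h
  · subst h
    have h₁ : r - (i.val - (i.val - i.val - 1)) = r - (i.val + 1 - (i.val - i.val + 1 - 1)) + 1 := by
      omega
    rw [h₁]
    push_cast
    ring
  · have hne : i.val ≠ j.val := fun h' => h (Fin.ext h')
    have h₁ : r - (j.val - (j.val - i.val - 1)) = r - (j.val + 1 - (j.val - i.val + 1 - 1)) := by
      omega
    rw [h₁]
    ring

lemma sum_Iio_shift {F : Type*} [Field F] {r : ℕ} {μ : Fin r → ℝ} (hμ : Antitone μ) {α : ℝ}
    {M N : Matrix (Fin r) (Fin r) (HahnSeries ℝ F)} {k kstar : Fin r → Fin r → ℝ}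
    (hk : RightFillingOf μ M N k)
    (hkstar : RightFillingOf μ M (N * Dmat F fun _ => α) kstar) {i j : Fin r} (hij : i ≤ j) :
    ∑ s ∈ Finset.Iio i, kstar s j = ∑ s ∈ Finset.Iio i, k s j := by
  rcases Nat.eq_zero_or_pos i.val with hi | hi
  · have h : Finset.Iio i = ∅ := Finset.eq_empty_of_forall_notMem fun x hx => by
      have hx' := Fin.lt_def.mp (Finset.mem_Iio.mp hx)
      omega
    rw [h, Finset.sum_empty, Finset.sum_empty]
  · let i' : Fin r := ⟨i.val - 1, by omega⟩
    have h : Finset.Iio i = Finset.Iic i' := by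
      ext x
      simp only [Finset.mem_Iio, Finset.mem_Iic, Fin.lt_def, Fin.le_def, i']
      omega
    have hlt : i' < j := by
      rw [Fin.le_def] at hij
      simp only [Fin.lt_def, i']
      omega
    rw [h, sum_Iic_shift hμ hk hkstar hlt.le, if_neg hlt.ne, add_zero]

lemma filling_shift {F : Type*} [Field F] {r : ℕ} {μ : Fin r → ℝ} (hμ : Antitone μ) {α : ℝ}
    {M N : Matrix (Fin r) (Fin r) (HahnSeries ℝ F)} {k kstar : Fin r → Fin r → ℝ}
    (hk : RightFillingOf μ M N k)
    (hkstar : RightFillingOf μ M (N * Dmat F fun _ => α) kstar) {i j : Fin r} (hij : i ≤ j) :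
    kstar i j = k i j + if i = j then α else 0 := by
  have h := sum_Iic_shift hμ hk hkstar hij
  rw [← Finset.Iio_insert, Finset.sum_insert (by simp), Finset.sum_insert (by simp),
    sum_Iio_shift hμ hk hkstar hij] at h
  linarith

/-- Multiplying `N` on the right by the scalar matrix
`D(α) = diag(t^α, …, t^α)` leaves the interior parts of the right filling unchanged and
shifts every edge part `k_ii` by `α`. -/
theorem scalar_shift_of_filling {r : ℕ} (μ ν lam : Fin r → ℝ)
    (M N : Matrix (Fin r) (Fin r) (HahnSeries ℝ K))
    (hM : M.det ≠ 0) (hN : N.det ≠ 0)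
    (hinvM : IsInv M μ) (hinvN : IsInv N ν) (hinvMN : IsInv (M * N) lam)
    (α : ℝ) (k kstar : Fin r → Fin r → ℝ)
    (hk : RightFillingOf μ M N k)
    (hkstar : RightFillingOf μ M (N * Dmat K fun _ => α) kstar) :
    (∀ i j : Fin r, i < j → kstar i j = k i j) ∧
    (∀ i : Fin r, kstar i i = k i i + α) :=
  ⟨fun i j hij => by
      simpa [hij.ne] using filling_shift hinvM.1 hk hkstar hij.le,
    fun i => by simpa using filling_shift hinvM.1 hk hkstar (le_refl i)⟩

end
end
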